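/- Let (R, m) be a two-dimensional regular local ring with infinite residue field and I an integrally closed m-primary ideal. Then I is the ideal of maximal minors of an indecomposable integrally closed R-module of rank two if and only if one of the following holds: (1) ord(I) >= 3; (2) ord(I) = 2 and I is simple; (3) ord(I) = 2 and I = JK with J, K simple integrally closed ideals and J + K ≠ m. -/

import Mathlib

open IsLocalRing

variable {R : Type*} [CommRing R]

/-- `r` lies in the integral closure of the ideal `I`. -/
def MemIntClIdeal (I : Ideal R) (r : R) : Prop :=
  ∃ n : ℕ, 0 < n ∧ ∃ c : ℕ → R, (∀ i, 1 ≤ i → i ≤ n → c i ∈ I ^ i) ∧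
    r ^ n + ∑ i ∈ Finset.Icc 1 n, c i * r ^ (n - i) = 0

/-- An ideal is integrally closed if it contains its integral closure. -/
def IsIntClIdeal (I : Ideal R) : Prop := ∀ r, MemIntClIdeal I r → r ∈ I

/-- Determinant of the 2×2 matrix with columns `v`, `w`. -/
def det2 (v w : Fin 2 → R) : R := v 0 * w 1 - v 1 * w 0

/-- The ideal of maximal minors `I(M)` of a rank-two module `M ⊆ R²`. -/
def minorsIdeal (M : Submodule R (Fin 2 → R)) : Ideal R :=
  Ideal.span {r | ∃ v ∈ M, ∃ w ∈ M, det2 v w = r}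

/-- The ideal `I₁(M)` generated by the entries of a matrix whose columns generate `M`. -/
def entriesIdeal (M : Submodule R (Fin 2 → R)) : Ideal R :=
  Ideal.span {r | ∃ v ∈ M, r = v 0 ∨ r = v 1}

/-- `v` is integral over the module `M` (Rees' determinantal criterion). -/
def MemIntClMod (M : Submodule R (Fin 2 → R)) (v : Fin 2 → R) : Prop :=
  ∀ w ∈ M, MemIntClIdeal (minorsIdeal M) (det2 v w)

/-- `M ⊆ R²` is integrally closed. -/
def IsIntClMod (M : Submodule R (Fin 2 → R)) : Prop :=
  ∀ v, MemIntClMod M v → v ∈ M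

/-- `M` is indecomposable as a direct sum. -/
def IsIndecomposable (M : Submodule R (Fin 2 → R)) : Prop :=
  ∀ N P : Submodule R (Fin 2 → R), N ⊔ P = M → N ⊓ P = ⊥ → N = ⊥ ∨ P = ⊥

/-- `M` has a nonzero free direct summand. -/
def HasFreeSummand (M : Submodule R (Fin 2 → R)) : Prop :=
  ∃ N P : Submodule R (Fin 2 → R), N ⊔ P = M ∧ N ⊓ P = ⊥ ∧ N ≠ ⊥ ∧ Module.Free R N

/-- An ideal is simple if it is not the product of two proper ideals. -/
def IsSimpleIdeal (I : Ideal R) : Prop :=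
  I ≠ ⊤ ∧ ∀ J K : Ideal R, I = J * K → J = ⊤ ∨ K = ⊤

section RegularParameters

/-- `x, y` is a regular system of parameters: a pair generating the maximal ideal. -/
def IsParams [IsLocalRing R] (x y : R) : Prop := maximalIdeal R = Ideal.span {x, y}

variable [IsLocalRing R]

theorem maximalIdeal_notMem_minimalPrimes_span_singleton [IsNoetherianRing R]
    (hdim : ringKrullDim R = 2) (z : R) : maximalIdeal R ∉ (Ideal.span {z}).minimalPrimes := by
  intro hmem
  have h1 := Ideal.height_le_one_of_isPrincipal_of_mem_minimalPrimes _ _ hmem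
  have h2 := maximalIdeal_height_eq_ringKrullDim (R := R)
  rw [hdim] at h2
  have h3 : ((maximalIdeal R).height : WithBot ℕ∞) ≤ ((1 : ℕ∞) : WithBot ℕ∞) := by
    exact_mod_cast h1
  rw [h2] at h3
  exact absurd h3 (by decide)

namespace IsParams

variable {x y : R}

theorem symm (h : IsParams x y) : IsParams y x := by
  unfold IsParams at *
  rw [h, Set.pair_comm]

theorem fst_mem (h : IsParams x y) : x ∈ maximalIdeal R := by
  rw [h]; exact Ideal.subset_span (by simp)

theorem snd_mem (h : IsParams x y) : y ∈ maximalIdeal R := h.symm.fst_mem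

theorem exists_eq (h : IsParams x y) {a : R} (ha : a ∈ maximalIdeal R) :
    ∃ s t, a = s * x + t * y := by
  rw [h, Ideal.mem_span_pair] at ha
  obtain ⟨s, t, e⟩ := ha
  exact ⟨s, t, e.symm⟩

/-- An invertible linear substitution carries parameters to parameters. -/
theorem linear (h : IsParams x y) {a b c d : R} (hu : IsUnit (a * d - b * c)) :
    IsParams (a * x + b * y) (c * x + d * y) := by
  obtain ⟨u, hu⟩ := hu.exists_left_inv
  apply le_antisymm
  · rw [h, Ideal.span_le]
    rintro z (rfl | rfl)
    · exact Ideal.mem_span_pair.2 ⟨u * d, -u * b, by linear_combination z * hu⟩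
    · exact Ideal.mem_span_pair.2 ⟨-u * c, u * a, by linear_combination z * hu⟩
  · rw [Ideal.span_le]
    rintro z (rfl | rfl) <;>
    exact add_mem (Ideal.mul_mem_left _ _ h.fst_mem) (Ideal.mul_mem_left _ _ h.snd_mem)

theorem exists_eq_of_mem_pow_succ (h : IsParams x y) {r : ℕ} :
    ∀ {a : R}, a ∈ maximalIdeal R ^ (r + 1) →
      ∃ t, ∃ g ∈ maximalIdeal R ^ r, a = t * y ^ (r + 1) + x * g := by
  induction r with
  | zero =>
    intro a ha
    rw [zero_add, pow_one] at ha
    obtain ⟨s, t, rfl⟩ := h.exists_eq ha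
    exact ⟨t, s, by simp, by ring⟩
  | succ r ih =>
    intro a ha
    rw [pow_succ] at ha
    refine Submodule.mul_induction_on ha ?_ ?_
    · intro b hb c hc
      obtain ⟨s, t', rfl⟩ := h.exists_eq hc
      obtain ⟨t, g, hg, e⟩ := ih hb
      refine ⟨t * t', s * b + t' * (g * y), add_mem (Ideal.mul_mem_left _ _ hb)
        (Ideal.mul_mem_left _ _ (Ideal.mul_mem_mul hg h.snd_mem)), ?_⟩
      rw [e]; ring
    · rintro _ _ ⟨t, g, hg, rfl⟩ ⟨t', g', hg', rfl⟩
      exact ⟨t + t', g + g', add_mem hg hg', by ring⟩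

theorem exists_coeffs_of_mem_pow_succ (h : IsParams x y) {r : ℕ} {a : R}
    (ha : a ∈ maximalIdeal R ^ (r + 1)) :
    ∃ s ∈ maximalIdeal R ^ r, ∃ t ∈ maximalIdeal R ^ r, a = s * x + t * y := by
  obtain ⟨t, g, hg, rfl⟩ := h.exists_eq_of_mem_pow_succ ha
  exact ⟨g, hg, t * y ^ r, Ideal.mul_mem_left _ _ (Ideal.pow_mem_pow h.snd_mem r), by ring⟩

theorem exists_quadratic (h : IsParams x y) {a : R} (ha : a ∈ maximalIdeal R ^ 2) :
    ∃ p q r, a = p * x ^ 2 + q * (x * y) + r * y ^ 2 := by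
  obtain ⟨t, g, hg, rfl⟩ := h.exists_eq_of_mem_pow_succ ha
  rw [pow_one] at hg
  obtain ⟨s, s', rfl⟩ := h.exists_eq hg
  exact ⟨s, s', t, by ring⟩

variable [IsNoetherianRing R]

theorem not_dvd_pow (hdim : ringKrullDim R = 2) (h : IsParams x y) (n : ℕ) : ¬ x ∣ y ^ n := by
  intro hx
  have hmem : maximalIdeal R ∈ (Ideal.span {x}).minimalPrimes := by
    refine ⟨⟨inferInstance, (Ideal.span_singleton_le_iff_mem _).2 h.fst_mem⟩, ?_⟩
    rintro p ⟨hp, hxp⟩ -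
    rw [Ideal.span_singleton_le_iff_mem] at hxp
    rw [h, Ideal.span_le]
    rintro z (rfl | rfl)
    · exact hxp
    · exact hp.mem_of_pow_mem n (p.mem_of_dvd hx hxp)
  exact maximalIdeal_notMem_minimalPrimes_span_singleton hdim x hmem

/-- Modulo `x`, every element is zero or a unit times a power of `y`. -/
theorem dvd_or_exists_unit (h : IsParams x y) (a : R) :
    x ∣ a ∨ ∃ n u, IsUnit u ∧ x ∣ a - u * y ^ n := by
  generalize hI : Ideal.span {x, a} = I
  induction I using WellFoundedGT.induction generalizing a with
  | ind I ih =>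
  by_cases hxa : x ∣ a
  · exact .inl hxa
  right
  by_cases hu : IsUnit a
  · exact ⟨0, a, hu, by simp⟩
  obtain ⟨s, t, rfl⟩ := h.exists_eq ((mem_maximalIdeal a).2 hu)
  have hxt : ¬ x ∣ t := fun hd => hxa (dvd_add (dvd_mul_left _ _) (hd.mul_right _))
  have hlt : I < Ideal.span {x, t} := by
    rw [← hI]
    refine lt_of_le_not_ge ?_ fun hle => hxt ?_
    · rw [Ideal.span_le]
      rintro z (rfl | rfl)
      · exact Ideal.subset_span (by simp)
      · exact Ideal.mem_span_pair.2 ⟨s, y, by ring⟩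
    · obtain ⟨p, q, e⟩ := Ideal.mem_span_pair.1 (hle (Ideal.subset_span (by simp) : t ∈ _))
      have hunit : IsUnit (1 - q * y) :=
        isUnit_one_sub_self_of_mem_nonunits _ (Ideal.mul_mem_left _ _ h.snd_mem)
      rw [← hunit.dvd_mul_right]
      exact ⟨p + q * s, by linear_combination -e⟩
  obtain hd | ⟨n, u, hu, w, hw⟩ := ih _ hlt t rfl
  · exact absurd hd hxt
  · exact ⟨n + 1, u, hu, s + w * y, by linear_combination y * hw⟩

theorem prime_fst (hdim : ringKrullDim R = 2) (h : IsParams x y) : Prime x := by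
  refine ⟨?_, h.fst_mem, ?_⟩
  · rintro rfl
    refine maximalIdeal_notMem_minimalPrimes_span_singleton hdim y
      ⟨⟨inferInstance, (Ideal.span_singleton_le_iff_mem _).2 h.snd_mem⟩, ?_⟩
    rintro p ⟨hp, hyp⟩ -
    rwa [h, Ideal.span_insert_zero]
  · intro a b hab
    by_contra! hn
    obtain ⟨n, u, hu, c, hc⟩ := (h.dvd_or_exists_unit a).resolve_left hn.1
    obtain ⟨k, v, hv, d, hd⟩ := (h.dvd_or_exists_unit b).resolve_left hn.2
    obtain ⟨e, he⟩ := hab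
    refine h.not_dvd_pow hdim (n + k) ((hu.mul hv).dvd_mul_left.1 ⟨e - c * b - d * u * y ^ n, ?_⟩)
    linear_combination he - b * hc - u * y ^ n * hd

theorem not_dvd (hdim : ringKrullDim R = 2) (h : IsParams x y) : ¬ x ∣ y := by
  simpa using h.not_dvd_pow hdim 1

theorem coeffs_of_linear_mem (hdim : ringKrullDim R = 2) (h : IsParams x y) {a b : R}
    (hab : a * x + b * y ∈ maximalIdeal R ^ 2) :
    a ∈ maximalIdeal R ∧ b ∈ maximalIdeal R := by
  have key : ∀ {x y a b : R}, IsParams x y → a * x + b * y ∈ maximalIdeal R ^ 2 →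
      b ∈ maximalIdeal R := by
    intro x y a b h hab
    obtain ⟨t, g, hg, e⟩ := h.exists_eq_of_mem_pow_succ hab
    have hd : x ∣ (b - t * y) * y := ⟨g - a, by linear_combination e⟩
    obtain ⟨c, hc⟩ := ((h.prime_fst hdim).dvd_or_dvd hd).resolve_right (h.not_dvd hdim)
    rw [show b = t * y + x * c by linear_combination hc]
    exact add_mem (Ideal.mul_mem_left _ _ h.snd_mem) (Ideal.mul_mem_right _ _ h.fst_mem)
  exact ⟨key h.symm (by rwa [add_comm]), key h hab⟩

variable [IsDomain R]

theorem mem_pow_of_mul_mem (hdim : ringKrullDim R = 2) (h : IsParams x y) {j : R} {r : ℕ}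
    (hj : x * j ∈ maximalIdeal R ^ (r + 1)) : j ∈ maximalIdeal R ^ r := by
  obtain ⟨t, g, hg, e⟩ := h.exists_eq_of_mem_pow_succ hj
  have hx := h.prime_fst hdim
  have hd : x ∣ t * y ^ (r + 1) := ⟨j - g, by linear_combination -e⟩
  obtain ⟨c, rfl⟩ := (hx.dvd_or_dvd hd).resolve_right (h.not_dvd_pow hdim _)
  have : j = g + y ^ r * (c * y) :=
    mul_left_cancel₀ hx.ne_zero (by linear_combination e)
  rw [this]
  exact add_mem hg (Ideal.mul_mem_right _ _ (Ideal.pow_mem_pow h.snd_mem r))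

theorem coeffs_of_quadratic_mem (hdim : ringKrullDim R = 2) (h : IsParams x y) {a b c : R}
    (habc : a * x ^ 2 + b * (x * y) + c * y ^ 2 ∈ maximalIdeal R ^ 3) :
    a ∈ maximalIdeal R ∧ b ∈ maximalIdeal R ∧ c ∈ maximalIdeal R := by
  have hc : c ∈ maximalIdeal R := by
    obtain ⟨t, g, hg, e⟩ := h.exists_eq_of_mem_pow_succ habc
    have hd : x ∣ (c - t * y) * y ^ 2 := ⟨g - a * x - b * y, by linear_combination e⟩
    obtain ⟨d, hd⟩ := ((h.prime_fst hdim).dvd_or_dvd hd).resolve_right (h.not_dvd_pow hdim 2)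
    rw [show c = t * y + x * d by linear_combination hd]
    exact add_mem (Ideal.mul_mem_left _ _ h.snd_mem) (Ideal.mul_mem_right _ _ h.fst_mem)
  have hcy : c * y ^ 2 ∈ maximalIdeal R ^ 3 := by
    rw [pow_succ' _ 2]; exact Ideal.mul_mem_mul hc (Ideal.pow_mem_pow h.snd_mem 2)
  have hx : x * (a * x + b * y) ∈ maximalIdeal R ^ 3 := by
    have := sub_mem habc hcy
    rwa [show x * (a * x + b * y) = a * x ^ 2 + b * (x * y) + c * y ^ 2 - c * y ^ 2 by ring]
  obtain ⟨ha, hb⟩ := h.coeffs_of_linear_mem hdim (h.mem_pow_of_mul_mem hdim hx)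
  exact ⟨ha, hb, hc⟩

end IsParams

end RegularParameters

section Integrality

theorem memIntClIdeal_of_mem {I : Ideal R} {r : R} (hr : r ∈ I) : MemIntClIdeal I r := by
  refine ⟨1, one_pos, fun _ => -r, fun i h1 h2 => ?_, by simp⟩
  obtain rfl : i = 1 := le_antisymm h2 h1
  simpa using hr

/-- Integrality over an ideal via the determinant trick. -/
theorem memIntClIdeal_of_mul_le [IsDomain R] {I T : Ideal R} (hT : T.FG) (hT0 : T ≠ ⊥) {z : R}
    (hz : ∀ t ∈ T, z * t ∈ I * T) : MemIntClIdeal I z := by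
  have : Module.Finite R T := Module.Finite.iff_fg.2 hT
  have hrange : LinearMap.range (z • (LinearMap.id : T →ₗ[R] T)) ≤ I • ⊤ := by
    rintro _ ⟨t, rfl⟩
    have h1 := hz t t.2
    have h2 : (I • (⊤ : Submodule R T)).map T.subtype = I * T := by
      rw [Submodule.map_smul'', Submodule.map_top, Submodule.range_subtype, smul_eq_mul]
    rw [← h2] at h1
    obtain ⟨s, hs, e⟩ := h1
    have : s = (z • (LinearMap.id : T →ₗ[R] T)) t := Subtype.ext (by simpa using e)
    rwa [← this]
  obtain ⟨p, hp, -, hc, h0⟩ :=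
    LinearMap.exists_monic_and_natDegree_eq_and_coeff_mem_pow_and_aeval_eq_zero R _ I hrange
  have hroot : p.eval z = 0 := by
    obtain ⟨t, ht, ht0⟩ := Submodule.exists_mem_ne_zero_of_ne_bot hT0
    have h1 : p.eval z * t = 0 := by
      have h2 := congrArg Subtype.val (LinearMap.congr_fun h0 ⟨t, ht⟩)
      have h3 : z • (LinearMap.id : T →ₗ[R] T) = algebraMap R (Module.End R T) z := rfl
      rw [h3, Polynomial.aeval_algebraMap_apply] at h2
      simpa using h2
    exact (mul_eq_zero.1 h1).resolve_right ht0
  have hpos : 0 < p.natDegree := by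
    rw [pos_iff_ne_zero]
    intro hd
    rw [hp.natDegree_eq_zero.1 hd] at hroot
    simp at hroot
  refine ⟨p.natDegree, hpos, fun i => p.coeff (p.natDegree - i), fun i _ hi => ?_, ?_⟩
  · have := hc (p.natDegree - i)
    rwa [Nat.sub_sub_self hi] at this
  · rw [Polynomial.eval_eq_sum_range, ← Finset.sum_range_reflect, Finset.sum_range_succ'] at hroot
    rw [← hroot, add_comm]
    congr 1
    · rw [Finset.range_eq_Ico, Finset.sum_Ico_add' (fun k => p.coeff (p.natDegree + 1 - 1 - k) *
        z ^ (p.natDegree + 1 - 1 - k)) 0 _ 1]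
      exact Finset.sum_congr (by ext; simp) fun i _ => by simp
    · simp [hp]


variable [IsLocalRing R] [IsNoetherianRing R]

/-- An ideal containing a regular parameter is integrally closed. -/
theorem IsParams.isIntClIdeal_of_mem (hdim : ringKrullDim R = 2) {x y : R} (h : IsParams x y)
    {J : Ideal R} (hx : x ∈ J) : IsIntClIdeal J := by
  intro r ⟨N, hN, c, hc, e⟩
  by_contra hr
  have hJx : Ideal.span {x} ≤ J := (Ideal.span_singleton_le_iff_mem _).2 hx
  have hdvd : ∀ {z}, x ∣ z → z ∈ J := fun hz => J.mem_of_dvd hz hx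
  obtain ⟨n, u, hu, hru⟩ := (h.dvd_or_exists_unit r).resolve_left fun hd => hr (hdvd hd)
  have hyn : ∀ k ≤ n, y ^ k ∉ J := fun k hk hy => hr <| by
    have h1 := add_mem (hdvd hru) (J.mul_mem_left u (J.mem_of_dvd (pow_dvd_pow y hk) hy))
    rwa [sub_add_cancel] at h1
  let φ := Ideal.Quotient.mk (Ideal.span {x})
  have hφ : ∀ {a b : R}, φ a = φ b ↔ x ∣ a - b := by
    intro a b; rw [Ideal.Quotient.eq, Ideal.mem_span_singleton]
  have hφ0 : ∀ {a : R}, φ a = 0 ↔ x ∣ a := by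
    intro a; rw [Ideal.Quotient.eq_zero_iff_mem, Ideal.mem_span_singleton]
  have hmap : J.map φ ≤ Ideal.span {φ y ^ (n + 1)} := by
    rw [Ideal.map_le_iff_le_comap]
    intro a ha
    rw [Ideal.mem_comap, Ideal.mem_span_singleton]
    obtain hd | ⟨k, v, hv, hd⟩ := h.dvd_or_exists_unit a
    · rw [hφ0.2 hd]; exact dvd_zero _
    · have hk : n + 1 ≤ k := by
        by_contra! hk
        refine hyn k (by omega) ?_
        have h1 := sub_mem ha (hdvd hd)
        rw [sub_sub_cancel] at h1
        exact (J.unit_mul_mem_iff_mem hv).1 h1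
      rw [hφ.2 hd, map_mul, map_pow]
      exact (pow_dvd_pow _ hk).mul_left _
  have hc' : ∀ i, 1 ≤ i → i ≤ N → φ y ^ (n * N + 1) ∣ φ (c i * r ^ (N - i)) := by
    intro i h1 h2
    have h3 : φ y ^ ((n + 1) * i) ∣ φ (c i) := by
      have h4 : φ (c i) ∈ (J.map φ) ^ i := by
        rw [← Ideal.map_pow]; exact Ideal.mem_map_of_mem _ (hc i h1 h2)
      have h5 := Ideal.pow_right_mono hmap i h4
      rwa [Ideal.span_singleton_pow, Ideal.mem_span_singleton, ← pow_mul] at h5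
    have h6 : φ y ^ (n * (N - i)) ∣ φ (r ^ (N - i)) := by
      rw [map_pow, hφ.2 hru, map_mul, map_pow, mul_pow, ← pow_mul]
      exact dvd_mul_left _ _
    rw [map_mul]
    refine (pow_dvd_pow _ ?_).trans ((pow_add (φ y) _ _).symm ▸ mul_dvd_mul h3 h6)
    obtain ⟨k, rfl⟩ := Nat.exists_eq_add_of_le h2
    rw [Nat.add_sub_cancel_left]
    nlinarith
  have hr' : φ y ^ (n * N + 1) ∣ φ (r ^ N) := by
    have h7 : φ (r ^ N) = -∑ i ∈ Finset.Icc 1 N, φ (c i * r ^ (N - i)) := by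
      rw [← map_sum, ← map_neg]
      exact congrArg φ (eq_neg_of_add_eq_zero_left e)
    rw [h7, dvd_neg]
    exact Finset.dvd_sum fun i hi => hc' i (Finset.mem_Icc.1 hi).1 (Finset.mem_Icc.1 hi).2
  rw [map_pow, hφ.2 hru] at hr'
  obtain ⟨q, hq⟩ := hr'
  obtain ⟨q, rfl⟩ := Ideal.Quotient.mk_surjective q
  have h8 : x ∣ (u ^ N - y * q) * y ^ (n * N) := by
    rw [← hφ0]
    change _ = φ y ^ (n * N + 1) * φ q at hq
    simp only [map_mul, map_sub, map_pow] at hq ⊢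
    rw [mul_pow, ← pow_mul] at hq
    linear_combination hq
  have h9 : IsUnit (u ^ N - y * q) := by
    rw [← notMem_maximalIdeal]
    intro h10
    have h11 := add_mem h10 (Ideal.mul_mem_right q _ h.snd_mem)
    rw [sub_add_cancel] at h11
    exact (notMem_maximalIdeal.2 (hu.pow N)) h11
  exact h.not_dvd_pow hdim _ (h9.dvd_mul_left.1 h8)

theorem IsParams.ne_bot (hdim : ringKrullDim R = 2) {x y : R} (h : IsParams x y) (n : ℕ) :
    maximalIdeal R ^ n ≠ ⊥ := by
  intro h0
  have := Ideal.pow_mem_pow h.snd_mem n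
  rw [h0, Ideal.mem_bot] at this
  exact h.not_dvd_pow hdim n (this ▸ dvd_zero x)

variable [IsDomain R]

/-- An integrally closed ideal containing `y ^ r + x g` of minimal order is contracted from
the quadratic transform inverting `x`. -/
theorem IsParams.mul_mem_of_mul_mem (hdim : ringKrullDim R = 2) {x y : R} (h : IsParams x y)
    {I : Ideal R} (hI : IsIntClIdeal I) {s : ℕ} (hs : I ≤ maximalIdeal R ^ (s + 2))
    {g : R} (hg : g ∈ maximalIdeal R ^ (s + 1)) (hf : y ^ (s + 2) + x * g ∈ I)
    {j : R} (hj : x * j ∈ I) : y * j ∈ I := by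
  have hjm : j ∈ maximalIdeal R ^ (s + 1) := h.mem_pow_of_mul_mem hdim (hs hj)
  refine hI _ (memIntClIdeal_of_mul_le (IsNoetherian.noetherian _) (h.ne_bot hdim (s + 1)) ?_)
  intro t ht
  obtain ⟨t₀, g', hg', rfl⟩ := h.exists_eq_of_mem_pow_succ ht
  have e : y * j * (t₀ * y ^ (s + 1) + x * g') =
      (y ^ (s + 2) + x * g) * (t₀ * j) + (x * j) * (g' * y - t₀ * g) := by ring
  rw [e]
  exact add_mem (Ideal.mul_mem_mul hf (Ideal.mul_mem_left _ _ hjm))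
    (Ideal.mul_mem_mul hj (sub_mem (Ideal.mul_mem_mul hg' h.snd_mem) (Ideal.mul_mem_left _ _ hg)))

/-- If `xy` lies in an integrally closed ideal, then so does the `x²` part of each element. -/
theorem IsParams.sq_part_mem (hdim : ringKrullDim R = 2) {x y : R} (h : IsParams x y)
    {I : Ideal R} (hI : IsIntClIdeal I) (hxy : x * y ∈ I) {a b c : R}
    (habc : a * x ^ 2 + b * (x * y) + c * y ^ 2 ∈ I) : a * x ^ 2 ∈ I := by
  refine hI _ (memIntClIdeal_of_mul_le (IsNoetherian.noetherian (maximalIdeal R))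
    (by simpa using h.ne_bot hdim 1) ?_)
  intro t ht
  obtain ⟨s, t, rfl⟩ := h.exists_eq ht
  have e : a * x ^ 2 * (s * x + t * y) = (a * x ^ 2 + b * (x * y) + c * y ^ 2) * (s * x) +
      (x * y) * ((a * t - s * b) * x + (- s * c) * y) := by ring
  rw [e]
  exact add_mem (Ideal.mul_mem_mul habc (Ideal.mul_mem_left _ _ h.fst_mem))
    (Ideal.mul_mem_mul hxy (add_mem (Ideal.mul_mem_left _ _ h.fst_mem)
      (Ideal.mul_mem_left _ _ h.snd_mem)))

theorem IsParams.sq_part_mem' (hdim : ringKrullDim R = 2) {x y : R} (h : IsParams x y)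
    {I : Ideal R} (hI : IsIntClIdeal I) (hxy : x * y ∈ I) {a b c : R}
    (habc : a * x ^ 2 + b * (x * y) + c * y ^ 2 ∈ I) : c * y ^ 2 ∈ I :=
  h.symm.sq_part_mem hdim hI (by rwa [mul_comm]) (a := c) (b := b) (c := a)
    (by convert habc using 1; ring)

theorem IsParams.mul_mem_of_colon (hdim : ringKrullDim R = 2) {x y : R} (h : IsParams x y)
    {I : Ideal R} (hI : IsIntClIdeal I) (hxy : x * y ∈ I) {a b : R} (ha : a ∈ maximalIdeal R)
    (hb : b ∈ maximalIdeal R) (hay : a * y ∈ I) (hbx : b * x ∈ I) : a * b ∈ I := by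
  obtain ⟨p, q, rfl⟩ := h.exists_eq ha
  obtain ⟨s, t, rfl⟩ := h.exists_eq hb
  have h1 : q * y ^ 2 ∈ I := h.sq_part_mem' hdim hI hxy (a := 0) (b := p) (by
    convert hay using 1; ring)
  have h2 : s * x ^ 2 ∈ I := h.sq_part_mem hdim hI hxy (b := t) (c := 0) (by
    convert hbx using 1; ring)
  have e : (p * x + q * y) * (s * x + t * y) =
      p * (s * x ^ 2) + t * (q * y ^ 2) + (p * t + q * s) * (x * y) := by ring
  rw [e]
  exact add_mem (add_mem (I.mul_mem_left _ h2) (I.mul_mem_left _ h1)) (I.mul_mem_left _ hxy)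

end Integrality

section Decomposable

theorem det2_add_left (u v w : Fin 2 → R) : det2 (u + v) w = det2 u w + det2 v w := by
  simp only [det2, Pi.add_apply]; ring

theorem det2_add_right (u v w : Fin 2 → R) : det2 u (v + w) = det2 u v + det2 u w := by
  simp only [det2, Pi.add_apply]; ring

theorem det2_smul_left (a : R) (v w : Fin 2 → R) : det2 (a • v) w = a * det2 v w := by
  simp only [det2, Pi.smul_apply, smul_eq_mul]; ring

theorem det2_smul_right (a : R) (v w : Fin 2 → R) : det2 v (a • w) = a * det2 v w := by
  simp only [det2, Pi.smul_apply, smul_eq_mul]; ring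

theorem det2_mem_minorsIdeal {M : Submodule R (Fin 2 → R)} {v w : Fin 2 → R} (hv : v ∈ M)
    (hw : w ∈ M) : det2 v w ∈ minorsIdeal M :=
  Ideal.subset_span ⟨v, hv, w, hw, rfl⟩

theorem IsIntClMod.mem_of_forall {M : Submodule R (Fin 2 → R)} (hM : IsIntClMod M)
    {v : Fin 2 → R} (hv : ∀ w ∈ M, det2 v w ∈ minorsIdeal M) : v ∈ M :=
  hM v fun w hw => memIntClIdeal_of_mem (hv w hw)

/-- A vector with a unit entry spans a direct summand. -/
theorem IsIndecomposable.apply_not_isUnit {M : Submodule R (Fin 2 → R)} (hM : IsIndecomposable M)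
    (h0 : minorsIdeal M ≠ ⊥) {v : Fin 2 → R} (hv : v ∈ M) (i : Fin 2) : ¬ IsUnit (v i) := by
  intro hu
  obtain ⟨a, ha⟩ := hu.exists_left_inv
  have hinf : Submodule.span R {v} ⊓ (M ⊓ LinearMap.ker (LinearMap.proj (R := R) i)) = ⊥ := by
    rw [eq_bot_iff]
    rintro w ⟨hw, -, hw0⟩
    obtain ⟨c, rfl⟩ := Submodule.mem_span_singleton.1 hw
    have : c * v i = 0 := by simpa using hw0
    rw [hu.mul_left_eq_zero] at this
    simp [this]
  have hsup : Submodule.span R {v} ⊔ (M ⊓ LinearMap.ker (LinearMap.proj (R := R) i)) = M := by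
    refine le_antisymm (sup_le ((Submodule.span_singleton_le_iff_mem _ _).2 hv) inf_le_left) ?_
    intro w hw
    have h1 : (w i * a) • v ∈ Submodule.span R {v} :=
      Submodule.smul_mem _ _ (Submodule.mem_span_singleton_self v)
    rw [← add_sub_cancel ((w i * a) • v) w]
    refine Submodule.add_mem_sup h1 ⟨sub_mem hw (M.smul_mem _ hv), ?_⟩
    simp [mul_assoc, ha]
  obtain h | h := hM _ _ hsup hinf
  · rw [Submodule.span_singleton_eq_bot] at h
    have : Nontrivial R := by
      by_contra! hn
      exact h0 (Subsingleton.elim _ _)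
    rw [h] at hu
    exact not_isUnit_zero hu
  · rw [h, sup_bot_eq] at hsup
    refine h0 (Ideal.span_eq_bot.2 ?_)
    rintro _ ⟨p, hp, q, hq, rfl⟩
    rw [← hsup] at hp hq
    obtain ⟨c, rfl⟩ := Submodule.mem_span_singleton.1 hp
    obtain ⟨d, rfl⟩ := Submodule.mem_span_singleton.1 hq
    simp only [det2, Pi.smul_apply, smul_eq_mul]; ring

/-- Coordinates with respect to a basis of `R²`. -/
theorem exists_coords {e₁ e₂ : Fin 2 → R} (he : IsUnit (det2 e₁ e₂)) (v : Fin 2 → R) :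
    ∃ a b : R, v = a • e₁ + b • e₂ := by
  obtain ⟨u, hu⟩ := he.exists_left_inv
  refine ⟨u * det2 v e₂, u * det2 e₁ v, ?_⟩
  ext i
  fin_cases i <;> simp [det2] at hu ⊢
  · linear_combination -(v 0) * hu
  · linear_combination -(v 1) * hu

variable [IsLocalRing R]

theorem apply_mem_of_indecomposable {M : Submodule R (Fin 2 → R)} (hM : IsIndecomposable M)
    (h0 : minorsIdeal M ≠ ⊥) {v : Fin 2 → R} (hv : v ∈ M) (i : Fin 2) : v i ∈ maximalIdeal R :=
  hM.apply_not_isUnit h0 hv i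

theorem minorsIdeal_le_sq {M : Submodule R (Fin 2 → R)}
    (hM : ∀ v ∈ M, ∀ i, v i ∈ maximalIdeal R) : minorsIdeal M ≤ maximalIdeal R ^ 2 := by
  rw [minorsIdeal, Ideal.span_le]
  rintro _ ⟨v, hv, w, hw, rfl⟩
  rw [SetLike.mem_coe, pow_two]
  exact sub_mem (Ideal.mul_mem_mul (hM v hv 0) (hM w hw 1))
    (Ideal.mul_mem_mul (hM v hv 1) (hM w hw 0))

variable [IsNoetherianRing R] [IsDomain R]

/-- An integrally closed module inside `m ⊕ m` containing `x e₁` and `y e₂` splits. -/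
theorem not_isIndecomposable_of_mem (hdim : ringKrullDim R = 2) {M : Submodule R (Fin 2 → R)}
    (hM : IsIntClMod M) (hI : IsIntClIdeal (minorsIdeal M))
    (hMm : ∀ v ∈ M, ∀ i, v i ∈ maximalIdeal R) {x y : R} (h : IsParams x y) {e₁ e₂ : Fin 2 → R}
    (he : IsUnit (det2 e₁ e₂)) (hx : x • e₁ ∈ M) (hy : y • e₂ ∈ M) : ¬ IsIndecomposable M := by
  have hself : ∀ v : Fin 2 → R, det2 v v = 0 := fun v => by simp only [det2]; ring
  have hanti : det2 e₂ e₁ = - det2 e₁ e₂ := by simp only [det2]; ring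
  have hxy : x * y ∈ minorsIdeal M := by
    have := det2_mem_minorsIdeal hx hy
    rw [det2_smul_left, det2_smul_right, ← mul_assoc] at this
    exact (Ideal.mul_unit_mem_iff_mem _ he).1 this
  have hcoord : ∀ a b : R, a • e₁ + b • e₂ ∈ M → (a ∈ maximalIdeal R ∧ a * y ∈ minorsIdeal M) ∧
      (b ∈ maximalIdeal R ∧ b * x ∈ minorsIdeal M) := by
    intro a b hab
    have h1 : det2 (a • e₁ + b • e₂) e₂ = a * det2 e₁ e₂ := by
      rw [det2_add_left, det2_smul_left, det2_smul_left, hself, mul_zero, add_zero]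
    have h2 : det2 e₁ (a • e₁ + b • e₂) = b * det2 e₁ e₂ := by
      rw [det2_add_right, det2_smul_right, det2_smul_right, hself, mul_zero, zero_add]
    refine ⟨⟨?_, ?_⟩, ?_, ?_⟩
    · rw [← Ideal.mul_unit_mem_iff_mem _ he, ← h1]
      exact sub_mem (Ideal.mul_mem_right _ _ (hMm _ hab 0)) (Ideal.mul_mem_right _ _ (hMm _ hab 1))
    · have := det2_mem_minorsIdeal hab hy
      rw [det2_smul_right, h1] at this
      rw [← Ideal.mul_unit_mem_iff_mem _ he]
      convert this using 1; ring
    · rw [← Ideal.mul_unit_mem_iff_mem _ he, ← h2]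
      exact sub_mem (Ideal.mul_mem_left _ _ (hMm _ hab 1)) (Ideal.mul_mem_left _ _ (hMm _ hab 0))
    · have := det2_mem_minorsIdeal hx hab
      rw [det2_smul_left, h2] at this
      rw [← Ideal.mul_unit_mem_iff_mem _ he]
      convert this using 1; ring
  have hsplit : ∀ a b : R, a • e₁ + b • e₂ ∈ M → a • e₁ ∈ M := by
    intro a b hab
    refine hM.mem_of_forall fun w hw => ?_
    obtain ⟨c, d, rfl⟩ := exists_coords he w
    have : det2 (a • e₁) (c • e₁ + d • e₂) = a * d * det2 e₁ e₂ := by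
      rw [det2_smul_left, det2_add_right, det2_smul_right, det2_smul_right, hself]; ring
    rw [this, Ideal.mul_unit_mem_iff_mem _ he]
    obtain ⟨⟨ha, hay⟩, -⟩ := hcoord a b hab
    obtain ⟨-, hd, hdx⟩ := hcoord c d hw
    exact h.mul_mem_of_colon hdim hI hxy ha hd hay hdx
  intro hind
  have hsup : (M ⊓ Submodule.span R {e₁}) ⊔ (M ⊓ Submodule.span R {e₂}) = M := by
    refine le_antisymm (sup_le inf_le_left inf_le_left) fun w hw => ?_
    obtain ⟨c, d, rfl⟩ := exists_coords he w
    have h1 := hsplit c d hw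
    have h2 : d • e₂ ∈ M := by simpa using sub_mem hw h1
    exact Submodule.add_mem_sup
      ⟨h1, Submodule.smul_mem _ _ (Submodule.mem_span_singleton_self _)⟩
      ⟨h2, Submodule.smul_mem _ _ (Submodule.mem_span_singleton_self _)⟩
  have hinf : (M ⊓ Submodule.span R {e₁}) ⊓ (M ⊓ Submodule.span R {e₂}) = ⊥ := by
    rw [eq_bot_iff]
    rintro w ⟨⟨-, h1⟩, -, h2⟩
    obtain ⟨c, rfl⟩ := Submodule.mem_span_singleton.1 h1
    obtain ⟨d, hd⟩ := Submodule.mem_span_singleton.1 h2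
    have : c * det2 e₁ e₂ = 0 := by
      rw [← det2_smul_left, ← hd, det2_smul_left, hself, mul_zero]
    rw [he.mul_left_eq_zero] at this
    simp [this]
  have hne : ∀ {z : R} {e : Fin 2 → R}, z ≠ 0 → e ≠ 0 → z • e ∈ M →
      M ⊓ Submodule.span R {e} ≠ ⊥ := by
    intro z e hz he hze h0
    have : z • e ∈ M ⊓ Submodule.span R {e} :=
      ⟨hze, Submodule.smul_mem _ _ (Submodule.mem_span_singleton_self _)⟩
    rw [h0, Submodule.mem_bot, smul_eq_zero] at this
    exact this.elim hz he
  obtain h1 | h1 := hind _ _ hsup hinf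
  · exact hne (h.prime_fst hdim).ne_zero (by rintro rfl; simp [det2] at he) hx h1
  · exact hne (h.symm.prime_fst hdim).ne_zero (by rintro rfl; simp [det2] at he) hy h1

end Decomposable

section Lifting

variable [IsLocalRing R]

theorem isUnit_iff_of_sub_mem {a b : R} (h : a - b ∈ maximalIdeal R) : IsUnit a ↔ IsUnit b := by
  rw [← residue_ne_zero_iff_isUnit, ← residue_ne_zero_iff_isUnit,
    sub_eq_zero.1 ((map_sub (residue R) a b).symm.trans ((residue_eq_zero_iff _).2 h))]

theorem isUnit_of_sub_one_mem {a : R} (h : a - 1 ∈ maximalIdeal R) : IsUnit a :=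
  (isUnit_iff_of_sub_mem h).2 isUnit_one

/-- `M` contains the columns of a matrix, in a suitable basis of `R²`, whose diagonal entries are
regular parameters and whose off-diagonal entries lie in `m ^ n`. -/
def HasDiagonalMod (M : Submodule R (Fin 2 → R)) (n : ℕ) : Prop :=
  ∃ (x y : R) (e₁ e₂ : Fin 2 → R) (b c : R), IsParams x y ∧ IsUnit (det2 e₁ e₂) ∧
    b ∈ maximalIdeal R ^ n ∧ c ∈ maximalIdeal R ^ n ∧ x • e₁ + b • e₂ ∈ M ∧ c • e₁ + y • e₂ ∈ M

theorem HasDiagonalMod.succ {M : Submodule R (Fin 2 → R)} {n : ℕ}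
    (hM : HasDiagonalMod M (n + 2)) : HasDiagonalMod M (n + 3) := by
  obtain ⟨x, y, e₁, e₂, b, c, h, he, hb, hc, hv, hw⟩ := hM
  obtain ⟨b₁, hb₁, b₂, hb₂, rfl⟩ := h.exists_coeffs_of_mem_pow_succ hb
  obtain ⟨c₁, hc₁, c₂, hc₂, rfl⟩ := h.exists_coeffs_of_mem_pow_succ hc
  have hm : ∀ {z : R}, z ∈ maximalIdeal R ^ (n + 1) → z ∈ maximalIdeal R := fun hz =>
    Ideal.pow_le_self (by omega) hz
  have hu : IsUnit (1 - b₁ * c₂) := isUnit_of_sub_one_mem (by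
    rw [show 1 - b₁ * c₂ - 1 = -(b₁ * c₂) by ring]
    exact neg_mem (Ideal.mul_mem_right _ _ (hm hb₁)))
  obtain ⟨ε, hε⟩ := hu.exists_left_inv
  have hsmall : ∀ {p q r : R}, p ∈ maximalIdeal R ^ (n + 1) → q ∈ maximalIdeal R ^ (n + 2) →
      p * q * r ∈ maximalIdeal R ^ (n + 3) := by
    intro p q r hp hq
    refine Ideal.mul_mem_right _ _ (Ideal.pow_le_pow_right (by omega : n + 3 ≤ n + 1 + (n + 2)) ?_)
    rw [pow_add]
    exact Ideal.mul_mem_mul hp hq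
  refine ⟨(1 - b₂ * ε * c₁) * x + (-(b₂ * ε * c₂)) * y,
    (-(c₁ * ε * b₁)) * x + (1 - c₁ * ε * b₂) * y, e₁ + b₁ • e₂, e₂ + c₂ • e₁,
    b₂ * (c₁ * x + c₂ * y) * (ε * b₁), c₁ * (b₁ * x + b₂ * y) * (ε * c₂), h.linear ?_, ?_,
    hsmall hb₂ hc, hsmall hc₁ hb, ?_, ?_⟩
  · refine isUnit_of_sub_one_mem ?_
    have e : (1 - b₂ * ε * c₁) * (1 - c₁ * ε * b₂) - -(b₂ * ε * c₂) * -(c₁ * ε * b₁) - 1 =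
      b₂ * (-2 * ε * c₁ + ε ^ 2 * c₁ ^ 2 * b₂ - ε ^ 2 * c₂ * c₁ * b₁) := by ring
    rw [e]
    exact Ideal.mul_mem_right _ _ (hm hb₂)
  · have e : det2 (e₁ + b₁ • e₂) (e₂ + c₂ • e₁) = (1 - b₁ * c₂) * det2 e₁ e₂ := by
      simp only [det2, Pi.add_apply, Pi.smul_apply, smul_eq_mul]; ring
    rw [e]
    exact hu.mul he
  · convert sub_mem hv (M.smul_mem b₂ hw) using 1
    ext i
    simp only [Pi.add_apply, Pi.sub_apply, Pi.smul_apply, smul_eq_mul]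
    linear_combination -b₂ * (c₁ * x + c₂ * y) * (e₁ i) * hε
  · convert sub_mem hw (M.smul_mem c₁ hv) using 1
    ext i
    simp only [Pi.add_apply, Pi.sub_apply, Pi.smul_apply, smul_eq_mul]
    linear_combination -c₁ * (b₁ * x + b₂ * y) * (e₂ i) * hε

theorem HasDiagonalMod.all {M : Submodule R (Fin 2 → R)} (hM : HasDiagonalMod M 2) (n : ℕ) :
    HasDiagonalMod M (n + 2) := by
  induction n with
  | zero => exact hM
  | succ n ih => exact ih.succ

variable [IsNoetherianRing R] [IsDomain R]

theorem hasDiagonalMod_two_of_isUnit (hdim : ringKrullDim R = 2)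
    {M : Submodule R (Fin 2 → R)} {x y : R} (h : IsParams x y) {a b c d : Fin 2 → R}
    (hv : x • a + y • b ∈ M) (hw : x • c + y • d ∈ M)
    (hdet : det2 (x • a + y • b) (x • c + y • d) - x * y ∈ maximalIdeal R ^ 3)
    (hu : IsUnit (det2 a d)) : HasDiagonalMod M 2 := by
  obtain ⟨s, t, rfl⟩ := exists_coords hu c
  obtain ⟨t', s', rfl⟩ := exists_coords hu b
  have e : det2 (x • a + y • (t' • a + s' • d)) (x • (s • a + t • d) + y • d) - x * y =
      t * det2 a d * x ^ 2 + ((1 + t' * t - s' * s) * det2 a d - 1) * (x * y)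
        + t' * det2 a d * y ^ 2 := by
    simp only [det2, Pi.add_apply, Pi.smul_apply, smul_eq_mul]; ring
  rw [e] at hdet
  obtain ⟨ht, h1, ht'⟩ := h.coeffs_of_quadratic_mem hdim hdet
  rw [Ideal.mul_unit_mem_iff_mem _ hu] at ht ht'
  have h2 : IsUnit (1 - s' * s) := by
    have h3 : IsUnit ((1 - s' * s) * det2 a d) := by
      refine isUnit_of_sub_one_mem ?_
      have e' : (1 - s' * s) * det2 a d - 1 =
          (1 + t' * t - s' * s) * det2 a d - 1 - t' * (t * det2 a d) := by ring
      rw [e']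
      exact sub_mem h1 (Ideal.mul_mem_right _ _ ht')
    exact isUnit_of_mul_isUnit_left h3
  have hsq : ∀ {p q z : R}, p ∈ maximalIdeal R → q ∈ maximalIdeal R →
      p * q * z ∈ maximalIdeal R ^ 2 := by
    intro p q z hp hq
    rw [pow_two]
    exact Ideal.mul_mem_right _ _ (Ideal.mul_mem_mul hp hq)
  refine ⟨(1 - s' * s) * x + t' * y, t * x + (1 - s' * s) * y, a, d, t * x * (-s'),
    t' * y * (-s), h.linear ?_, hu, hsq ht h.fst_mem, hsq ht' h.snd_mem, ?_, ?_⟩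
  · refine (isUnit_iff_of_sub_mem ?_).2 (h2.mul h2)
    rw [sub_sub_cancel_left]
    exact neg_mem (Ideal.mul_mem_right _ _ ht')
  · convert sub_mem hv (M.smul_mem s' hw) using 1
    module
  · convert sub_mem hw (M.smul_mem s hv) using 1
    module

/-- If the leading form of some minor of `M` is a product of two distinct linear forms, then the
corresponding columns can be diagonalized modulo `m²`. -/
theorem hasDiagonalMod_two (hdim : ringKrullDim R = 2) {M : Submodule R (Fin 2 → R)}
    {x y : R} (h : IsParams x y) (hM : ∀ v ∈ M, ∀ i, v i ∈ maximalIdeal R) {v w : Fin 2 → R}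
    (hv : v ∈ M) (hw : w ∈ M) (hdet : det2 v w - x * y ∈ maximalIdeal R ^ 3) :
    HasDiagonalMod M 2 := by
  have hlin : ∀ v ∈ M, ∃ a b : Fin 2 → R, v = x • a + y • b := by
    intro v hv
    choose a b hab using fun i => h.exists_eq (hM v hv i)
    exact ⟨a, b, funext fun i => by simp [hab i, mul_comm]⟩
  obtain ⟨a, b, rfl⟩ := hlin v hv
  obtain ⟨c, d, rfl⟩ := hlin w hw
  have hunit : IsUnit (det2 a d + det2 b c) := by
    have e : det2 (x • a + y • b) (x • c + y • d) - x * y =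
        det2 a c * x ^ 2 + (det2 a d + det2 b c - 1) * (x * y) + det2 b d * y ^ 2 := by
      simp only [det2, Pi.add_apply, Pi.smul_apply, smul_eq_mul]; ring
    rw [e] at hdet
    exact isUnit_of_sub_one_mem (h.coeffs_of_quadratic_mem hdim hdet).2.1
  obtain hu | hu := isUnit_or_isUnit_of_isUnit_add hunit
  · exact hasDiagonalMod_two_of_isUnit hdim h hv hw hdet hu
  · refine hasDiagonalMod_two_of_isUnit hdim h (a := c) (b := d) (c := -a) (d := -b) hw ?_ ?_ ?_
    · convert neg_mem hv using 1
      module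
    · convert hdet using 1
      simp only [det2, Pi.add_apply, Pi.smul_apply, Pi.neg_apply, smul_eq_mul]; ring
    · convert hu using 1
      simp only [det2, Pi.neg_apply]; ring

theorem not_isIndecomposable_of_det2 (hdim : ringKrullDim R = 2) {M : Submodule R (Fin 2 → R)}
    (hM : IsIntClMod M) (hI : IsIntClIdeal (minorsIdeal M))
    (hrad : (minorsIdeal M).radical = maximalIdeal R)
    (hMm : ∀ v ∈ M, ∀ i, v i ∈ maximalIdeal R) {x y : R} (h : IsParams x y) {v w : Fin 2 → R}
    (hv : v ∈ M) (hw : w ∈ M) (hdet : det2 v w - x * y ∈ maximalIdeal R ^ 3) :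
    ¬ IsIndecomposable M := by
  obtain ⟨n, hn⟩ := (minorsIdeal M).exists_radical_pow_le_of_fg (IsNoetherian.noetherian _)
  rw [hrad] at hn
  have hpow : ∀ {b : R} (e : Fin 2 → R), b ∈ maximalIdeal R ^ (n + 2) → b • e ∈ M := by
    intro b e hb
    refine hM.mem_of_forall fun w _ => ?_
    rw [det2_smul_left]
    exact Ideal.mul_mem_right _ _ (hn (Ideal.pow_le_pow_right (by omega) hb))
  obtain ⟨x', y', e₁, e₂, b, c, h', he, hb, hc, hv', hw'⟩ :=
    (hasDiagonalMod_two hdim h hMm hv hw hdet).all n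
  refine not_isIndecomposable_of_mem hdim hM hI hMm h' he ?_ ?_
  · simpa using sub_mem hv' (hpow e₂ hb)
  · simpa using sub_mem hw' (hpow e₁ hc)

/-- An integrally closed module inside `m ⊕ m` splits if its ideal of minors has order two and
contains a product of two parameters. -/
theorem not_isIndecomposable_of_mul_mem (hdim : ringKrullDim R = 2)
    {M : Submodule R (Fin 2 → R)} (hM : IsIntClMod M) (hI : IsIntClIdeal (minorsIdeal M))
    (hrad : (minorsIdeal M).radical = maximalIdeal R)
    (hMm : ∀ v ∈ M, ∀ i, v i ∈ maximalIdeal R) {x y : R} (h : IsParams x y)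
    (hxy : x * y ∈ minorsIdeal M) : ¬ IsIndecomposable M := by
  have key : ∀ {x y : R}, IsParams x y → x * y ∈ minorsIdeal M →
      (∀ a b c : R, a * x ^ 2 + b * (x * y) + c * y ^ 2 ∈ minorsIdeal M → c ∈ maximalIdeal R) →
      ¬ IsIndecomposable M := by
    intro x y h hxy hc
    by_contra hind
    have hle : minorsIdeal M ≤ Ideal.span {x ^ 2} ⊔ maximalIdeal R ^ 3 := by
      rw [minorsIdeal, Ideal.span_le]
      rintro _ ⟨v, hv, w, hw, rfl⟩
      have hvw := det2_mem_minorsIdeal hv hw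
      obtain ⟨a, b, c, e⟩ := h.exists_quadratic (minorsIdeal_le_sq hMm hvw)
      have hcm := hc a b c (e ▸ hvw)
      have hcy : c * y ^ 2 ∈ maximalIdeal R ^ 3 := by
        rw [pow_succ' _ 2]; exact Ideal.mul_mem_mul hcm (Ideal.pow_mem_pow h.snd_mem 2)
      have hbm : b ∈ maximalIdeal R := by
        by_contra hb
        rw [notMem_maximalIdeal] at hb
        refine not_isIndecomposable_of_det2 hdim hM hI hrad hMm
          (h.linear (a := 1) (b := 0) (c := a) (d := b) (by simpa)) hv hw ?_ hind
        rw [e]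
        convert hcy using 1; ring
      have hbxy : b * (x * y) ∈ maximalIdeal R ^ 3 := by
        rw [pow_succ' _ 2, pow_two]
        exact Ideal.mul_mem_mul hbm (Ideal.mul_mem_mul h.fst_mem h.snd_mem)
      rw [SetLike.mem_coe, e, add_assoc]
      exact Submodule.add_mem_sup (Ideal.mul_mem_left _ _ (Ideal.mem_span_singleton_self _))
        (add_mem hbxy hcy)
    obtain ⟨_, ha, z, hz, e⟩ := Submodule.mem_sup.1 (hle hxy)
    obtain ⟨a, rfl⟩ := Ideal.mem_span_singleton.1 ha
    have h1 : (-a) * x ^ 2 + 1 * (x * y) + 0 * y ^ 2 ∈ maximalIdeal R ^ 3 := by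
      convert hz using 1; linear_combination -e
    exact (Ideal.ne_top_iff_one _).1 (maximalIdeal.isMaximal R).ne_top
      (h.coeffs_of_quadratic_mem hdim h1).2.1
  by_cases hx : ∀ a b c : R, a * x ^ 2 + b * (x * y) + c * y ^ 2 ∈ minorsIdeal M →
      c ∈ maximalIdeal R
  · exact key h hxy hx
  by_cases hy : ∀ a b c : R, a * x ^ 2 + b * (x * y) + c * y ^ 2 ∈ minorsIdeal M →
      a ∈ maximalIdeal R
  · refine key h.symm (by rwa [mul_comm]) fun a b c hm => hy c b a ?_
    convert hm using 1; ring
  push Not at hx hy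
  obtain ⟨a, b, c, hm, hc⟩ := hx
  obtain ⟨a', b', c', hm', ha'⟩ := hy
  rw [notMem_maximalIdeal] at hc ha'
  have hy2 : y * y ∈ minorsIdeal M := by
    rw [← pow_two, ← Ideal.unit_mul_mem_iff_mem _ hc]
    exact h.sq_part_mem' hdim hI hxy hm
  have hx2 : x * x ∈ minorsIdeal M := by
    rw [← pow_two, ← Ideal.unit_mul_mem_iff_mem _ ha']
    exact h.sq_part_mem hdim hI hxy hm'
  have hmem : ∀ {z : R} (e : Fin 2 → R), x * z ∈ minorsIdeal M → y * z ∈ minorsIdeal M →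
      z • e ∈ M := by
    intro z e hxz hyz
    refine hM.mem_of_forall fun w hw => ?_
    have hz : ∀ t ∈ maximalIdeal R, z * t ∈ minorsIdeal M := by
      intro t ht
      obtain ⟨p, q, rfl⟩ := h.exists_eq ht
      convert add_mem (Ideal.mul_mem_left _ p hxz) (Ideal.mul_mem_left _ q hyz) using 1; ring
    rw [det2_smul_left]
    exact hz _ (sub_mem (Ideal.mul_mem_left _ _ (hMm w hw 1)) (Ideal.mul_mem_left _ _ (hMm w hw 0)))
  exact not_isIndecomposable_of_mem hdim hM hI hMm h (e₁ := ![1, 0]) (e₂ := ![0, 1])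
    (by simp [det2]) (hmem _ hx2 (by rwa [mul_comm])) (hmem _ hxy hy2)

end Lifting

section Factors

variable [IsLocalRing R]

theorem IsParams.exists_of_mem {x y l : R} (h : IsParams x y) (hl : l ∈ maximalIdeal R)
    (hl2 : l ∉ maximalIdeal R ^ 2) : ∃ z, IsParams l z := by
  obtain ⟨s, t, rfl⟩ := h.exists_eq hl
  by_cases hs : IsUnit s
  · exact ⟨_, h.linear (a := s) (b := t) (c := 0) (d := 1) (by simpa using hs)⟩
  by_cases ht : IsUnit t
  · exact ⟨_, h.linear (a := s) (b := t) (c := 1) (d := 0) (by simpa using ht)⟩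
  refine absurd ?_ hl2
  rw [pow_two]
  exact add_mem (Ideal.mul_mem_mul hs h.fst_mem) (Ideal.mul_mem_mul ht h.snd_mem)

theorem le_maximalIdeal_of_mul {I J K : Ideal R} (hI : I = J * K) (hJ : J ≠ ⊤) (hK : K ≠ ⊤)
    (hI3 : ¬ I ≤ maximalIdeal R ^ 3) :
    J ≤ maximalIdeal R ∧ ¬ J ≤ maximalIdeal R ^ 2 ∧
      K ≤ maximalIdeal R ∧ ¬ K ≤ maximalIdeal R ^ 2 := by
  have hJm := le_maximalIdeal hJ
  have hKm := le_maximalIdeal hK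
  refine ⟨hJm, fun hJ2 => hI3 ?_, hKm, fun hK2 => hI3 ?_⟩
  · rw [hI, pow_succ]; exact Ideal.mul_mono hJ2 hKm
  · rw [hI, pow_succ']; exact Ideal.mul_mono hJm hK2

theorem isSimpleIdeal_of_not_le {J : Ideal R} (hJ : J ≤ maximalIdeal R)
    (hJ2 : ¬ J ≤ maximalIdeal R ^ 2) : IsSimpleIdeal J := by
  refine ⟨fun h => maximalIdeal.isMaximal R |>.ne_top (top_le_iff.1 (h ▸ hJ)), ?_⟩
  rintro A B rfl
  by_contra! hAB
  refine hJ2 ?_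
  rw [pow_two]
  exact Ideal.mul_mono (le_maximalIdeal hAB.1) (le_maximalIdeal hAB.2)

theorem exists_isParams_of_sup_eq {x₀ y₀ : R} (h₀ : IsParams x₀ y₀) {J K : Ideal R}
    (hJ : ¬ J ≤ maximalIdeal R ^ 2) (hK : ¬ K ≤ maximalIdeal R ^ 2)
    (hsup : J ⊔ K = maximalIdeal R) : ∃ x ∈ J, ∃ y ∈ K, IsParams x y := by
  have hJm : J ≤ maximalIdeal R := hsup ▸ le_sup_left
  have hKm : K ≤ maximalIdeal R := hsup ▸ le_sup_right
  obtain ⟨l, hl, hl2⟩ := SetLike.not_le_iff_exists.1 hJ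
  obtain ⟨k, hk, hk2⟩ := SetLike.not_le_iff_exists.1 hK
  obtain ⟨z, h⟩ := h₀.exists_of_mem (hJm hl) hl2
  obtain ⟨a, b, rfl⟩ := h.exists_eq (hKm hk)
  by_cases hb : IsUnit b
  · refine ⟨l, hl, _, hk, ?_⟩
    simpa using h.linear (a := 1) (b := 0) (c := a) (d := b) (by simpa using hb)
  have ha : IsUnit a := by
    by_contra ha
    refine hk2 ?_
    rw [pow_two]
    exact add_mem (Ideal.mul_mem_mul ha h.fst_mem) (Ideal.mul_mem_mul hb h.snd_mem)
  obtain ⟨j, hj, k', hk', hz⟩ := Submodule.mem_sup.1 (hsup ▸ h.snd_mem : z ∈ J ⊔ K)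
  obtain ⟨c, d, rfl⟩ := h.exists_eq (hJm hj)
  obtain hd | hd := isUnit_or_isUnit_one_sub_self d
  · refine ⟨_, hj, _, hk, h.linear ((isUnit_iff_of_sub_mem (b := - (d * a)) ?_).2
      (hd.mul ha).neg)⟩
    rw [sub_neg_eq_add, sub_add_cancel]
    exact Ideal.mul_mem_left _ _ hb
  · refine ⟨l, hl, k', hk', ?_⟩
    have := h.linear (a := 1) (b := 0) (c := -c) (d := 1 - d) (by simpa using hd)
    convert this using 1
    · ring
    · linear_combination hz

variable [IsNoetherianRing R]

theorem IsParams.isIntClIdeal_of_not_le (hdim : ringKrullDim R = 2) {x y : R} (h : IsParams x y)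
    {J : Ideal R} (hJ : J ≤ maximalIdeal R) (hJ2 : ¬ J ≤ maximalIdeal R ^ 2) :
    IsIntClIdeal J := by
  obtain ⟨l, hl, hl2⟩ := SetLike.not_le_iff_exists.1 hJ2
  obtain ⟨z, hz⟩ := h.exists_of_mem (hJ hl) hl2
  exact hz.isIntClIdeal_of_mem hdim hl

/-- The minors of an indecomposable integrally closed module satisfy the stated conditions. -/
theorem conditions_of_isIndecomposable [IsDomain R] (hdim : ringKrullDim R = 2) {x₀ y₀ : R}
    (h₀ : IsParams x₀ y₀) {M : Submodule R (Fin 2 → R)} (h0 : minorsIdeal M ≠ ⊥)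
    (hM : IsIntClMod M) (hind : IsIndecomposable M) (hI : IsIntClIdeal (minorsIdeal M))
    (hrad : (minorsIdeal M).radical = maximalIdeal R)
    (hI3 : ¬ minorsIdeal M ≤ maximalIdeal R ^ 3) :
    minorsIdeal M ≤ maximalIdeal R ^ 2 ∧ (¬ IsSimpleIdeal (minorsIdeal M) →
      ∃ J K : Ideal R, IsSimpleIdeal J ∧ IsSimpleIdeal K ∧ IsIntClIdeal J ∧ IsIntClIdeal K ∧
        minorsIdeal M = J * K ∧ J ⊔ K ≠ maximalIdeal R) := by
  have hMm : ∀ v ∈ M, ∀ i, v i ∈ maximalIdeal R := fun v hv i =>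
    apply_mem_of_indecomposable hind h0 hv i
  have hI2 := minorsIdeal_le_sq hMm
  refine ⟨hI2, fun hns => ?_⟩
  have htop : minorsIdeal M ≠ ⊤ := fun h => by
    rw [h, Ideal.radical_top] at hrad
    exact (maximalIdeal.isMaximal R).ne_top hrad.symm
  simp only [IsSimpleIdeal, not_and, not_forall, not_or] at hns
  obtain ⟨J, K, e, hJ, hK⟩ := hns htop
  obtain ⟨hJm, hJ2, hKm, hK2⟩ := le_maximalIdeal_of_mul e hJ hK hI3
  refine ⟨J, K, isSimpleIdeal_of_not_le hJm hJ2, isSimpleIdeal_of_not_le hKm hK2,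
    h₀.isIntClIdeal_of_not_le hdim hJm hJ2, h₀.isIntClIdeal_of_not_le hdim hKm hK2, e,
    fun hsup => ?_⟩
  obtain ⟨x, hx, y, hy, h⟩ := exists_isParams_of_sup_eq h₀ hJ2 hK2 hsup
  exact not_isIndecomposable_of_mul_mem hdim hM hI hrad hMm h (e ▸ Ideal.mul_mem_mul hx hy) hind

end Factors

section Construction

/-- The module of vectors whose determinant with `(x, y)` lies in `I`. -/
def detColon (I : Ideal R) (x y : R) : Submodule R (Fin 2 → R) where
  carrier := {v | x * v 1 - y * v 0 ∈ I}
  add_mem' {v w} hv hw := by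
    have := I.add_mem hv hw
    simp only [Set.mem_ofPred_eq, Pi.add_apply] at this ⊢
    convert this using 1
    ring
  zero_mem' := by simp
  smul_mem' a v hv := by
    have := I.mul_mem_left a hv
    simp only [Set.mem_ofPred_eq, Pi.smul_apply, smul_eq_mul] at this ⊢
    convert this using 1
    ring

theorem mem_detColon {I : Ideal R} {x y : R} {v : Fin 2 → R} :
    v ∈ detColon I x y ↔ x * v 1 - y * v 0 ∈ I := Iff.rfl

theorem pair_mem_detColon (I : Ideal R) (x y : R) : ![x, y] ∈ detColon I x y := by
  simp [mem_detColon, mul_comm]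

theorem detColon_pair_of_mem {I : Ideal R} {x y : R} {v : Fin 2 → R} (h0 : v 0 ∈ I)
    (h1 : v 1 ∈ I) : v ∈ detColon I x y :=
  sub_mem (I.mul_mem_left _ h1) (I.mul_mem_left _ h0)

theorem isIntClMod_detColon {I : Ideal R} (hI : IsIntClIdeal I) {x y : R}
    (hM : minorsIdeal (detColon I x y) = I) : IsIntClMod (detColon I x y) := by
  intro v hv
  have := hI _ (hM ▸ hv _ (pair_mem_detColon I x y))
  rw [mem_detColon]
  rw [← neg_mem_iff] at this
  convert this using 1
  simp only [det2, Matrix.cons_val_zero, Matrix.cons_val_one]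
  ring

/-- Two submodules of `R²` with zero intersection, the second nonzero: the first has rank at most
one. -/
theorem det2_eq_zero_of_inf_eq_bot [IsDomain R] {N P : Submodule R (Fin 2 → R)} (hNP : N ⊓ P = ⊥) (hP : P ≠ ⊥)
    {v w : Fin 2 → R} (hv : v ∈ N) (hw : w ∈ N) : det2 v w = 0 := by
  obtain ⟨p, hp, hp0⟩ := Submodule.exists_mem_ne_zero_of_ne_bot hP
  have e : det2 v w • p = det2 p w • v + det2 v p • w := by
    ext i
    fin_cases i <;> simp [det2] <;> ring
  have hmem : det2 v w • p ∈ N ⊓ P :=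
    ⟨e ▸ add_mem (N.smul_mem _ hv) (N.smul_mem _ hw), P.smul_mem _ hp⟩
  rw [hNP, Submodule.mem_bot] at hmem
  exact (smul_eq_zero.1 hmem).resolve_right hp0

variable [IsLocalRing R]

theorem IsParams.le_minorsIdeal_detColon {x y : R} (h : IsParams x y) {I : Ideal R}
    (hI : I ≤ maximalIdeal R) : I ≤ minorsIdeal (detColon I x y) := by
  intro a ha
  obtain ⟨s, t, e⟩ := h.exists_eq (hI ha)
  have := det2_mem_minorsIdeal (pair_mem_detColon I x y)
    (show ![-t, s] ∈ detColon I x y by simpa [mem_detColon, e, mul_comm] using ha)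
  simpa [det2, e, mul_comm] using this

variable [IsNoetherianRing R] [IsDomain R]

theorem IsParams.exists_of_mem_detColon (hdim : ringKrullDim R = 2) {x y : R} (h : IsParams x y)
    {I : Ideal R} {s : ℕ} (hs : I ≤ maximalIdeal R ^ (s + 2)) {g : R}
    (hf : y ^ (s + 2) + x * g ∈ I) {v : Fin 2 → R} (hv : v ∈ detColon I x y) :
    ∃ c d j, x * j ∈ I ∧ v 0 = c * x - d * y ^ (s + 1) ∧ v 1 = c * y + d * g + j := by
  rw [mem_detColon] at hv
  obtain ⟨t, g', -, e⟩ := h.exists_eq_of_mem_pow_succ (hs hv)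
  have hp := h.prime_fst hdim
  have hj : x * (g' - t * g) ∈ I := by
    have := sub_mem hv (I.mul_mem_left t hf)
    rw [e] at this
    convert this using 1
    ring
  obtain ⟨c, hc⟩ := (hp.dvd_or_dvd (a := y) (b := v 0 + t * y ^ (s + 1))
    ⟨v 1 - g', by linear_combination -e⟩).resolve_left (h.not_dvd hdim)
  refine ⟨c, t, g' - t * g, hj, by linear_combination hc, ?_⟩
  refine mul_left_cancel₀ hp.ne_zero ?_
  linear_combination e + y * hc

theorem IsParams.minorsIdeal_detColon (hdim : ringKrullDim R = 2) {x y : R} (h : IsParams x y)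
    {I : Ideal R} (hI : IsIntClIdeal I) {s : ℕ} (hs : I ≤ maximalIdeal R ^ (s + 2)) {g : R}
    (hg : g ∈ maximalIdeal R ^ (s + 1)) (hf : y ^ (s + 2) + x * g ∈ I) :
    minorsIdeal (detColon I x y) = I := by
  refine le_antisymm ?_ (h.le_minorsIdeal_detColon (hs.trans (Ideal.pow_le_self (by omega))))
  rw [minorsIdeal, Ideal.span_le]
  rintro _ ⟨v, hv, w, hw, rfl⟩
  obtain ⟨c, d, j, hj, hv0, hv1⟩ := h.exists_of_mem_detColon hdim hs hf hv
  obtain ⟨c', d', j', hj', hw0, hw1⟩ := h.exists_of_mem_detColon hdim hs hf hw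
  have key : ∀ {j}, x * j ∈ I → y ^ (s + 1) * j ∈ I := fun hj => by
    rw [pow_succ, mul_assoc]
    exact I.mul_mem_left _ (h.mul_mem_of_mul_mem hdim hI hs hg hf hj)
  have := add_mem (add_mem (I.mul_mem_left (c * d' - d * c') hf)
    (sub_mem (I.mul_mem_left c hj') (I.mul_mem_left c' hj)))
    (sub_mem (I.mul_mem_left d' (key hj)) (I.mul_mem_left d (key hj')))
  rw [SetLike.mem_coe, det2, hv0, hv1, hw0, hw1]
  convert this using 1
  ring

/-- A module containing a power of `m` has no summand containing a vector of parameters. -/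
theorem IsParams.not_mem_summand (hdim : ringKrullDim R = 2) {I : Ideal R}
    (hrad : I.radical = maximalIdeal R) {N P : Submodule R (Fin 2 → R)}
    (hI : ∀ v : Fin 2 → R, v 0 ∈ I → v 1 ∈ I → v ∈ N ⊔ P) (hNP : N ⊓ P = ⊥) (hP : P ≠ ⊥)
    {n : Fin 2 → R} (h : IsParams (n 0) (n 1)) : n ∉ N := by
  intro hn
  obtain ⟨p, hp, hp0⟩ := Submodule.exists_mem_ne_zero_of_ne_bot hP
  have hn0 := h.prime_fst hdim
  have hn1 := h.symm.prime_fst hdim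
  have hN : N ≠ ⊥ := fun hb => by
    rw [hb, Submodule.mem_bot] at hn
    exact hn0.ne_zero (by simp [hn])
  have hdvd : ∀ v ∈ N ⊔ P, det2 p n ∣ det2 p v := by
    intro v hv
    obtain ⟨n', hn', p', hp', rfl⟩ := Submodule.mem_sup.1 hv
    have e := det2_eq_zero_of_inf_eq_bot hNP hP hn hn'
    rw [det2_add_right, det2_eq_zero_of_inf_eq_bot (inf_comm N P ▸ hNP) hN hp hp', add_zero]
    rw [det2, sub_eq_zero] at e
    obtain ⟨c, hc⟩ := (hn0.dvd_or_dvd (a := n 1) (b := n' 0) ⟨n' 1, e.symm⟩).resolve_left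
      (h.not_dvd hdim)
    have hc' : n' 1 = n 1 * c := by
      refine mul_left_cancel₀ hn0.ne_zero ?_
      linear_combination e + n 1 * hc
    exact ⟨c, by simp only [det2, hc, hc']; ring⟩
  have hdvd' : ∀ a ∈ I, det2 p n ∣ a * p 0 ∧ det2 p n ∣ a * p 1 := by
    intro a ha
    refine ⟨?_, ?_⟩
    · have := hdvd _ (hI ![0, a] (by simp) (by simpa using ha))
      simpa [det2, mul_comm] using this
    · have := hdvd _ (hI ![a, 0] (by simpa using ha) (by simp))
      simpa [det2, mul_comm] using this
  obtain ⟨k, hk⟩ : n 0 ∈ I.radical := hrad ▸ h.fst_mem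
  obtain ⟨l, hl⟩ : n 1 ∈ I.radical := hrad ▸ h.snd_mem
  have hD : det2 p n ≠ 0 := fun hD => hp0 <| by
    ext i
    have h0 : n 0 ^ k * p i = 0 := zero_dvd_iff.1 (hD ▸ by
      fin_cases i
      exacts [(hdvd' _ hk).1, (hdvd' _ hk).2])
    exact (mul_eq_zero.1 h0).resolve_left (pow_ne_zero _ hn0.ne_zero)
  have hdvdp : ∀ {z : R}, det2 p n ∣ n 0 ^ k * z → det2 p n ∣ n 1 ^ l * z → det2 p n ∣ z := by
    rintro z ⟨u, hu⟩ ⟨w, hw⟩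
    obtain ⟨u', rfl⟩ := hn0.pow_dvd_of_dvd_mul_left k (h.not_dvd_pow hdim l)
      (b := u) ⟨w, mul_left_cancel₀ hD (by linear_combination n 0 ^ k * hw - n 1 ^ l * hu)⟩
    exact ⟨u', mul_left_cancel₀ (pow_ne_zero k hn0.ne_zero) (by linear_combination hu)⟩
  obtain ⟨a, ha⟩ := hdvdp (hdvd' _ hk).1 (hdvd' _ hl).1
  obtain ⟨b, hb⟩ := hdvdp (hdvd' _ hk).2 (hdvd' _ hl).2
  have h1 : (1 : R) = a * n 1 - b * n 0 := mul_left_cancel₀ hD (by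
    nth_rewrite 1 [det2]
    rw [mul_one]
    linear_combination n 1 * ha - n 0 * hb)
  refine (Ideal.ne_top_iff_one _).1 (maximalIdeal.isMaximal R).ne_top (h1 ▸ ?_)
  exact sub_mem (Ideal.mul_mem_left _ _ h.snd_mem) (Ideal.mul_mem_left _ _ h.fst_mem)

/-- If every splitting of `(x, y)` in `detColon I x y` has a summand consisting of parameters, then
the module is indecomposable. -/
theorem isIndecomposable_detColon (hdim : ringKrullDim R = 2) {I : Ideal R}
    (hrad : I.radical = maximalIdeal R) {x y : R}
    (hsplit : ∀ v ∈ detColon I x y, ∀ w ∈ detColon I x y, v 0 + w 0 = x → v 1 + w 1 = y →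
      IsParams (v 0) (v 1) ∨ IsParams (w 0) (w 1)) : IsIndecomposable (detColon I x y) := by
  intro N P hsup hinf
  by_contra! hne
  have hI : ∀ v : Fin 2 → R, v 0 ∈ I → v 1 ∈ I → v ∈ N ⊔ P := fun v h0 h1 =>
    hsup ▸ detColon_pair_of_mem h0 h1
  obtain ⟨n, hn, p, hp, e⟩ := Submodule.mem_sup.1
    (hsup ▸ pair_mem_detColon I x y : ![x, y] ∈ N ⊔ P)
  have e0 : n 0 + p 0 = x := congr_fun e 0
  have e1 : n 1 + p 1 = y := congr_fun e 1
  obtain h | h := hsplit n (hsup ▸ Submodule.mem_sup_left hn) p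
    (hsup ▸ Submodule.mem_sup_right hp) e0 e1
  · exact h.not_mem_summand hdim hrad hI hinf hne.2 hn
  · exact h.not_mem_summand hdim hrad (sup_comm N P ▸ hI) (inf_comm N P ▸ hinf) hne.1 hp

end Construction

section InitialForms

variable [IsLocalRing R]

open Polynomial in
/-- The initial form of `a ∈ m ^ r`, restricted to the lines `x = t y`. -/
theorem IsParams.exists_initialForm {x y : R} (h : IsParams x y) {r : ℕ} :
    ∀ {a : R}, a ∈ maximalIdeal R ^ r → ∃ p : R[X],
      (∀ t, ∃ g ∈ maximalIdeal R ^ (r - 1), a = p.eval t * y ^ r + (x - t * y) * g) ∧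
      (p.map (residue R) = 0 → a ∈ maximalIdeal R ^ (r + 1)) := by
  induction r with
  | zero =>
    intro a _
    refine ⟨C a, fun t => ⟨0, zero_mem _, by simp⟩, fun hp => ?_⟩
    rwa [map_C, C_eq_zero, residue_eq_zero_iff, ← pow_one (maximalIdeal R)] at hp
  | succ r ih =>
    intro a ha
    obtain ⟨b, g, hg, rfl⟩ := h.exists_eq_of_mem_pow_succ ha
    obtain ⟨p, hp, hp0⟩ := ih hg
    refine ⟨C b + X * p, fun t => ?_, fun h0 => ?_⟩
    · obtain ⟨g', hg', e⟩ := hp t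
      refine ⟨g + t * (y * g'), add_mem hg (Ideal.mul_mem_left _ _ ?_), ?_⟩
      · cases r with
        | zero => simp
        | succ r => exact pow_succ' (maximalIdeal R) r ▸ Ideal.mul_mem_mul h.snd_mem hg'
      · simp only [eval_add, eval_C, eval_mul, eval_X]
        linear_combination t * y * e
    · have hb : b ∈ maximalIdeal R := by
        have := congr_arg (coeff · 0) h0
        rwa [coeff_map, coeff_add, coeff_C_zero, mul_coeff_zero, coeff_X_zero, zero_mul, add_zero,
          coeff_zero, residue_eq_zero_iff] at this
      have hg1 := hp0 (by
        rw [Polynomial.map_add, map_C, (residue_eq_zero_iff b).2 hb, C_0, zero_add,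
          Polynomial.map_mul, map_X] at h0
        exact (mul_eq_zero.1 h0).resolve_left X_ne_zero)
      rw [pow_succ']
      exact add_mem (Ideal.mul_mem_mul hb (Ideal.pow_mem_pow h.snd_mem _))
        (Ideal.mul_mem_mul h.fst_mem hg1)

theorem IsParams.exists_monic_mem [Infinite (ResidueField R)] {x y : R} (h : IsParams x y)
    {I : Ideal R} {r : ℕ} (hI : I ≤ maximalIdeal R ^ r) (hI' : ¬ I ≤ maximalIdeal R ^ (r + 1)) :
    ∃ x' g, IsParams x' y ∧ g ∈ maximalIdeal R ^ (r - 1) ∧ y ^ r + x' * g ∈ I := by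
  obtain ⟨f, hf, hf'⟩ := SetLike.not_le_iff_exists.1 hI'
  obtain ⟨p, hp, hp0⟩ := h.exists_initialForm (hI hf)
  obtain ⟨t, ht⟩ : ∃ t, (p.map (residue R)).eval t ≠ 0 := by
    by_contra! h0
    exact hf' (hp0 (Polynomial.funext fun t => by simpa using h0 t))
  obtain ⟨t, rfl⟩ := residue_surjective t
  rw [Polynomial.eval_map_apply, residue_ne_zero_iff_isUnit] at ht
  obtain ⟨u, hu⟩ := ht.exists_left_inv
  obtain ⟨g, hg, e⟩ := hp t
  refine ⟨x - t * y, u * g, ?_, Ideal.mul_mem_left _ _ hg, ?_⟩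
  · convert h.linear (a := 1) (b := -t) (c := 0) (d := 1) (by simp) using 1 <;> ring
  · convert I.mul_mem_left u hf using 1
    rw [e]
    linear_combination -y ^ r * hu

theorem exists_order [IsNoetherianRing R] {I : Ideal R} (hI : I ≠ ⊥) {k : ℕ} (hk : I ≤ maximalIdeal R ^ k) :
    ∃ s, I ≤ maximalIdeal R ^ (s + k) ∧ ¬ I ≤ maximalIdeal R ^ (s + k + 1) := by
  by_contra! hs
  have hall : ∀ s, I ≤ maximalIdeal R ^ (s + k) := fun s => by
    induction s with
    | zero => simpa using hk
    | succ s ih => exact (hs s ih).trans (Ideal.pow_le_pow_right (by omega))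
  refine hI (le_bot_iff.1 ?_)
  rw [← Ideal.iInf_pow_eq_bot_of_isLocalRing _ (maximalIdeal.isMaximal R).ne_top]
  exact le_iInf fun s => (hall s).trans (Ideal.pow_le_pow_right (by omega))

end InitialForms

section Indecomposable

variable [IsLocalRing R] [IsNoetherianRing R] [IsDomain R]

theorem IsParams.isIndecomposable_of_order_ge_three (hdim : ringKrullDim R = 2) {x y : R}
    (h : IsParams x y) {I : Ideal R} (hrad : I.radical = maximalIdeal R) {s : ℕ}
    (hs : I ≤ maximalIdeal R ^ (s + 3)) {g : R} (hg : g ∈ maximalIdeal R ^ (s + 2))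
    (hf : y ^ (s + 3) + x * g ∈ I) : IsIndecomposable (detColon I x y) := by
  have hle : maximalIdeal R ^ (s + 2) ≤ maximalIdeal R ^ 2 := Ideal.pow_le_pow_right (by omega)
  have key : ∀ {c d j v0 v1 : R}, x * j ∈ I → v0 = c * x - d * y ^ (s + 2) →
      v1 = c * y + d * g + j → IsUnit c → IsParams v0 v1 := by
    rintro c d j _ _ hj rfl rfl hc
    have hj2 := h.mem_pow_of_mul_mem hdim (hs hj)
    obtain ⟨p, hp, q, hq, e⟩ := h.exists_coeffs_of_mem_pow_succ
      (hle (add_mem (Ideal.mul_mem_left _ d hg) hj2))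
    rw [pow_one] at hp hq
    convert h.linear (a := c) (b := - d * y ^ (s + 1)) (c := p) (d := c + q)
      ((isUnit_iff_of_sub_mem (b := c * c) ?_).2 (hc.mul hc)) using 1
    · ring
    · linear_combination e
    · convert add_mem (Ideal.mul_mem_left _ c hq)
        (Ideal.mul_mem_left _ (d * y ^ (s + 1)) hp) using 1
      ring
  refine isIndecomposable_detColon hdim hrad fun v hv w hw e0 _ => ?_
  obtain ⟨c, d, j, hj, hv0, hv1⟩ := h.exists_of_mem_detColon hdim hs hf hv
  obtain ⟨c', d', j', hj', hw0, hw1⟩ := h.exists_of_mem_detColon hdim hs hf hw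
  by_cases hc : IsUnit c
  · exact .inl (key hj hv0 hv1 hc)
  by_cases hc' : IsUnit c'
  · exact .inr (key hj' hw0 hw1 hc')
  have hmem := (h.coeffs_of_linear_mem hdim (a := c + c' - 1) (b := -(d + d') * y ^ (s + 1)) (by
    convert Ideal.zero_mem _
    linear_combination e0 - hv0 - hw0)).1
  exact absurd (isUnit_of_sub_one_mem hmem) (Ideal.add_mem (maximalIdeal R) hc hc')

theorem IsParams.isIndecomposable_or_exists (hdim : ringKrullDim R = 2) {x y : R}
    (h : IsParams x y) {I : Ideal R} (hrad : I.radical = maximalIdeal R)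
    (hs : I ≤ maximalIdeal R ^ 2) {g : R} (hg : g ∈ maximalIdeal R)
    (hf : y ^ 2 + x * g ∈ I) (hcolon : ∀ j, x * j ∈ I → j ∈ maximalIdeal R ^ 2) :
    IsIndecomposable (detColon I x y) ∨
      ∃ x' y' f, IsParams x' y' ∧ f ∈ I ∧ f - x' * y' ∈ maximalIdeal R ^ 3 := by
  obtain ⟨a, b, rfl⟩ := h.exists_eq hg
  have key : ∀ {c d j v0 v1 : R}, x * j ∈ I → v0 = c * x - d * y ^ 1 →
      v1 = c * y + d * (a * x + b * y) + j → IsUnit (c ^ 2 + b * c * d + a * d ^ 2) →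
      IsParams v0 v1 := by
    rintro c d j _ _ hj rfl rfl hc
    obtain ⟨p, hp, q, hq, rfl⟩ := h.exists_coeffs_of_mem_pow_succ (hcolon j hj)
    rw [pow_one] at hp hq
    convert h.linear (a := c) (b := - d) (c := d * a + p) (d := c + d * b + q)
      ((isUnit_iff_of_sub_mem ?_).2 hc) using 1
    · ring
    · ring
    · convert add_mem (Ideal.mul_mem_left _ c hq) (Ideal.mul_mem_left _ d hp) using 1
      ring
  by_contra! hno
  refine hno.1 (isIndecomposable_detColon hdim hrad fun v hv w hw e0 _ => ?_)
  obtain ⟨c, d, j, hj, hv0, hv1⟩ := h.exists_of_mem_detColon (s := 0) hdim hs hf hv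
  obtain ⟨c', d', j', hj', hw0, hw1⟩ := h.exists_of_mem_detColon (s := 0) hdim hs hf hw
  rw [zero_add] at hv0 hw0
  by_contra! hpar
  have hQ : c ^ 2 + b * c * d + a * d ^ 2 ∈ maximalIdeal R := fun hu =>
    hpar.1 (key hj hv0 hv1 hu)
  have hQ' : c' ^ 2 + b * c' * d' + a * d' ^ 2 ∈ maximalIdeal R := fun hu =>
    hpar.2 (key hj' hw0 hw1 hu)
  obtain ⟨hc, hd⟩ := h.coeffs_of_linear_mem hdim (a := c + c' - 1) (b := -(d + d')) (by
    convert Ideal.zero_mem _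
    linear_combination e0 - hv0 - hw0)
  have htr : 2 * c + b * d - 1 ∈ maximalIdeal R := by
    rw [← residue_eq_zero_iff] at *
    simp only [map_add, map_sub, map_mul, map_neg, map_pow, map_one, map_ofNat] at *
    have h1 : residue R c' = 1 - residue R c := by linear_combination hc
    have h2 : residue R d' = - residue R d := by linear_combination -hd
    rw [h1, h2] at hQ'
    linear_combination hQ - hQ'
  have hdu : IsUnit d := by
    by_contra hdm
    have hcm : c ∈ maximalIdeal R := Ideal.IsPrime.mem_of_pow_mem inferInstance 2 (by
      convert sub_mem hQ (Ideal.mul_mem_left _ (b * c + a * d) hdm) using 1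
      ring)
    exact absurd (isUnit_of_sub_one_mem htr) (Ideal.add_mem _ (Ideal.mul_mem_left _ _ hcm)
      (Ideal.mul_mem_left _ _ hdm))
  refine hno.2 (-c * x + d * y) ((1 - c) * x + d * y) _ (h.linear (by
    convert hdu.neg using 1
    ring)) (I.mul_mem_left (d ^ 2) hf) ?_
  have hcoef : a * d ^ 2 + c - c ^ 2 ∈ maximalIdeal R := by
    convert sub_mem hQ (Ideal.mul_mem_left _ c htr) using 1
    ring
  have hx2 := Ideal.pow_mem_pow h.fst_mem 2
  have hxy : x * y ∈ maximalIdeal R ^ 2 := pow_two (maximalIdeal R) ▸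
    Ideal.mul_mem_mul h.fst_mem h.snd_mem
  rw [pow_succ']
  convert add_mem (Ideal.mul_mem_mul hcoef hx2)
    (Ideal.mul_mem_mul (Ideal.mul_mem_left _ d htr) hxy) using 1
  ring

end Indecomposable

section OrderTwo

variable [IsLocalRing R]

theorem IsParams.add_of_mem_sq {x y c d : R} (h : IsParams x y) (hc : c ∈ maximalIdeal R ^ 2)
    (hd : d ∈ maximalIdeal R ^ 2) : IsParams (x + c) (y + d) := by
  obtain ⟨p, hp, q, hq, rfl⟩ := h.exists_coeffs_of_mem_pow_succ hc
  obtain ⟨p', hp', q', hq', rfl⟩ := h.exists_coeffs_of_mem_pow_succ hd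
  rw [pow_one] at hp hp' hq hq'
  convert h.linear (a := 1 + p) (b := q) (c := p') (d := 1 + q') (isUnit_of_sub_one_mem ?_) using 1
  · ring
  · ring
  · convert sub_mem (add_mem (Ideal.mul_mem_left _ (1 + p) hq') hp)
      (Ideal.mul_mem_left _ q hp') using 1
    ring

/-- An initial form splitting into independent linear forms lifts to a product of parameters. -/
theorem IsParams.exists_mul_sub_mem {I : Ideal R} {x y f : R} (h : IsParams x y) (hf : f ∈ I)
    (hfxy : f - x * y ∈ maximalIdeal R ^ 3) (n : ℕ) :
    ∃ x y, IsParams x y ∧ ∃ f ∈ I, f - x * y ∈ maximalIdeal R ^ (n + 3) := by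
  induction n with
  | zero => exact ⟨x, y, h, f, hf, hfxy⟩
  | succ n ih =>
    obtain ⟨x, y, h, f, hf, hc⟩ := ih
    obtain ⟨c₁, hc₁, c₂, hc₂, e⟩ := h.exists_coeffs_of_mem_pow_succ hc
    have hle : maximalIdeal R ^ (n + 2) ≤ maximalIdeal R ^ 2 := Ideal.pow_le_pow_right (by omega)
    refine ⟨x + c₂, y + c₁, h.add_of_mem_sq (hle hc₂) (hle hc₁), f, hf, ?_⟩
    have hprod : c₂ * c₁ ∈ maximalIdeal R ^ (n + 1 + 3) := by
      have := Ideal.mul_mem_mul hc₂ hc₁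
      rw [← pow_add] at this
      exact Ideal.pow_le_pow_right (by omega) this
    rw [← neg_mem_iff] at hprod
    convert hprod using 1
    linear_combination e

theorem IsParams.exists_mul_mem {I : Ideal R} [IsNoetherianRing R]
    (hrad : I.radical = maximalIdeal R) {x y f : R} (h : IsParams x y) (hf : f ∈ I)
    (hfxy : f - x * y ∈ maximalIdeal R ^ 3) : ∃ x y, IsParams x y ∧ x * y ∈ I := by
  obtain ⟨n, hn⟩ := I.exists_radical_pow_le_of_fg (IsNoetherian.noetherian _)
  rw [hrad] at hn
  obtain ⟨x, y, h, f, hf, hd⟩ := h.exists_mul_sub_mem hf hfxy n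
  refine ⟨x, y, h, ?_⟩
  simpa using sub_mem hf (hn (Ideal.pow_le_pow_right (by omega) hd))

/-- If `J + K ≠ m`, then all initial forms of degree two in `JK` are multiples of one square. -/
theorem exists_sq_of_sup_ne {x₀ y₀ : R} (h₀ : IsParams x₀ y₀) {J K : Ideal R}
    (hJ : J ≤ maximalIdeal R) (hJ2 : ¬ J ≤ maximalIdeal R ^ 2) (hK : K ≤ maximalIdeal R)
    (hsup : J ⊔ K ≠ maximalIdeal R) :
    ∃ l ∈ maximalIdeal R, ∀ a ∈ J * K, ∃ c, a - c * l ^ 2 ∈ maximalIdeal R ^ 3 := by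
  obtain ⟨l, hl, hl2⟩ := SetLike.not_le_iff_exists.1 hJ2
  obtain ⟨z, h⟩ := h₀.exists_of_mem (hJ hl) hl2
  have hle : J ⊔ K ≤ maximalIdeal R := sup_le hJ hK
  have key : ∀ a ∈ J ⊔ K, ∃ c, ∃ e ∈ maximalIdeal R ^ 2, a = c * l + e := by
    intro a ha
    obtain ⟨c, d, rfl⟩ := h.exists_eq (hle ha)
    refine ⟨c, d * z, ?_, rfl⟩
    rw [pow_two]
    refine Ideal.mul_mem_mul (fun hd => hsup (le_antisymm hle ?_)) h.snd_mem
    have hl' : l ∈ J ⊔ K := Submodule.mem_sup_left hl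
    obtain ⟨u, hu⟩ := hd.exists_left_inv
    have hz : z ∈ J ⊔ K := by
      convert Ideal.mul_mem_left _ u (sub_mem ha (Ideal.mul_mem_left _ c hl')) using 1
      linear_combination -z * hu
    rw [h, Ideal.span_le]
    rintro w (rfl | rfl)
    exacts [hl', hz]
  refine ⟨l, hJ hl, fun a ha => Submodule.mul_induction_on ha ?_ ?_⟩
  · intro b hb k hk
    have hb' := hJ hb
    obtain ⟨c, e, he, rfl⟩ := key b (Submodule.mem_sup_left hb)
    obtain ⟨c', e', he', rfl⟩ := key k (Submodule.mem_sup_right hk)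
    refine ⟨c * c', ?_⟩
    have := add_mem (Ideal.mul_mem_mul he' hb')
      (Ideal.mul_mem_mul he (Ideal.mul_mem_left _ c' (hJ hl)))
    rw [← pow_succ] at this
    convert this using 1
    ring
  · rintro b k ⟨c, hc⟩ ⟨c', hc'⟩
    refine ⟨c + c', ?_⟩
    convert add_mem hc hc' using 1
    ring

variable [IsNoetherianRing R]

theorem IsParams.not_mem_of_le_sq (hdim : ringKrullDim R = 2) {x y : R} (h : IsParams x y)
    {I : Ideal R} (hI2 : I ≤ maximalIdeal R ^ 2) : x ∉ I ∧ y ∉ I := by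
  have key : ∀ {x y : R}, IsParams x y → x ∉ I := fun {x y} h hx => by
    have := (h.coeffs_of_linear_mem hdim (a := 1) (b := 0) (by simpa using hI2 hx)).1
    exact (Ideal.ne_top_iff_one _).1 (maximalIdeal.isMaximal R).ne_top this
  exact ⟨key h, key h.symm⟩

variable [IsDomain R]

theorem IsParams.not_isSimpleIdeal_of_mul_mem (hdim : ringKrullDim R = 2) {x y : R}
    (h : IsParams x y) {I : Ideal R} (hI : IsIntClIdeal I) (hI2 : I ≤ maximalIdeal R ^ 2)
    (hxy : x * y ∈ I) : ¬ IsSimpleIdeal I := by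
  have hmem : ∀ {a b : R}, a ∈ I.colon {b} ↔ a * b ∈ I := fun {a b} => by
    rw [Submodule.mem_colon_singleton, smul_eq_mul]
  obtain ⟨hx, hy⟩ := h.not_mem_of_le_sq hdim hI2
  have hne : ∀ {b : R}, b ∉ I → I.colon {b} ≠ ⊤ := fun hb htop => hb <| by
    rwa [Ideal.eq_top_iff_one, hmem, one_mul] at htop
  intro hs
  refine (hs.2 (I.colon {y}) (I.colon {x}) (le_antisymm (fun a ha => ?_) ?_)).elim (hne hy) (hne hx)
  · obtain ⟨p, q, r, rfl⟩ := h.exists_quadratic (hI2 ha)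
    have hp := h.sq_part_mem hdim hI hxy ha
    have hr := h.sq_part_mem' hdim hI hxy ha
    have hx1 : x ∈ I.colon {y} := hmem.2 hxy
    have hy1 : y ∈ I.colon {x} := hmem.2 (mul_comm x y ▸ hxy)
    have hpx : p * x ∈ I.colon {x} := hmem.2 (by convert hp using 1; ring)
    have hry : r * y ∈ I.colon {y} := hmem.2 (by convert hr using 1; ring)
    convert add_mem (add_mem (Ideal.mul_mem_mul hx1 hpx)
      (Ideal.mul_mem_left _ q (Ideal.mul_mem_mul hx1 hy1))) (Ideal.mul_mem_mul hry hy1) using 1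
    ring
  · rw [Ideal.mul_le]
    intro a ha b hb
    exact h.mul_mem_of_colon hdim hI hxy (le_maximalIdeal (hne hy) ha)
      (le_maximalIdeal (hne hx) hb) (hmem.1 ha) (hmem.1 hb)

theorem IsParams.sup_eq_of_mul_mem (hdim : ringKrullDim R = 2) {x y : R} (h : IsParams x y)
    {J K : Ideal R} (hJ : J ≤ maximalIdeal R) (hJ2 : ¬ J ≤ maximalIdeal R ^ 2)
    (hK : K ≤ maximalIdeal R) (hxy : x * y ∈ J * K) : J ⊔ K = maximalIdeal R := by
  by_contra hsup
  obtain ⟨l, hl, hsq⟩ := exists_sq_of_sup_ne h hJ hJ2 hK hsup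
  obtain ⟨a, b, rfl⟩ := h.exists_eq hl
  obtain ⟨c, hc⟩ := hsq _ hxy
  obtain ⟨h1, h2, h3⟩ := h.coeffs_of_quadratic_mem hdim (a := -c * a ^ 2) (b := 1 - 2 * c * a * b)
    (c := -c * b ^ 2) (by convert hc using 1; ring)
  rw [← residue_eq_zero_iff] at h1 h2 h3
  simp only [map_sub, map_mul, map_neg, map_pow, map_one, map_ofNat] at h1 h2 h3
  have h0 : residue R c * residue R a * residue R b = 0 :=
    pow_eq_zero_iff two_ne_zero |>.1 (by
      linear_combination -residue R c * residue R b ^ 2 * h1)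
  exact one_ne_zero (α := ResidueField R) (by linear_combination h2 + 2 * h0)

theorem IsParams.not_isSimpleIdeal_of_colon (hdim : ringKrullDim R = 2) {x y : R}
    (h : IsParams x y) {I : Ideal R} (hI : IsIntClIdeal I) (hI2 : I ≤ maximalIdeal R ^ 2)
    {g : R} (hg : g ∈ maximalIdeal R) (hf : y ^ 2 + x * g ∈ I) {j : R} (hj : x * j ∈ I)
    (hj2 : j ∉ maximalIdeal R ^ 2) : ¬ IsSimpleIdeal I := by
  have hy : ∀ {j}, x * j ∈ I → y * j ∈ I := fun hj =>
    h.mul_mem_of_mul_mem hdim hI (s := 0) hI2 (by simpa using hg) hf hj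
  have htop := (maximalIdeal.isMaximal R).ne_top
  intro hs
  obtain ⟨j₀, j₁, rfl⟩ := h.exists_eq (a := j) (by
    simpa using h.mem_pow_of_mul_mem hdim (r := 1) (hI2 hj))
  by_cases hj₁ : IsUnit j₁
  · have hmem : ∀ {a : R}, a ∈ I.colon {x} ↔ x * a ∈ I := fun {a} => by
      rw [Submodule.mem_colon_singleton, smul_eq_mul, mul_comm]
    obtain ⟨u, hu⟩ := hj₁.exists_left_inv
    refine (hs.2 (maximalIdeal R) (I.colon {x})
      (le_antisymm (fun a ha => ?_) ?_)).elim htop fun hx => ?_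
    · obtain ⟨p, q, -, rfl⟩ := h.exists_eq_of_mem_pow_succ (hI2 ha)
      have hq : q - p * u * j₀ * y ∈ I.colon {x} := hmem.2 (by
        convert sub_mem ha (I.mul_mem_left (p * u) (hy hj)) using 1
        linear_combination p * y ^ 2 * hu)
      convert add_mem (Ideal.mul_mem_mul h.fst_mem hq)
        (Ideal.mul_mem_left _ (p * u) (Ideal.mul_mem_mul h.snd_mem (hmem.2 hj))) using 1
      linear_combination -p * y ^ 2 * hu
    · rw [Ideal.mul_le]
      intro a ha b hb
      obtain ⟨s, t, rfl⟩ := h.exists_eq ha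
      convert add_mem (I.mul_mem_left s (hmem.1 hb)) (I.mul_mem_left t (hy (hmem.1 hb))) using 1
      ring
    · rw [Ideal.eq_top_iff_one, hmem, mul_one] at hx
      exact (h.not_mem_of_le_sq hdim hI2).1 hx
  · have hj₀ : IsUnit j₀ := by
      by_contra hj₀
      refine hj2 ?_
      rw [pow_two]
      exact add_mem (Ideal.mul_mem_mul hj₀ h.fst_mem) (Ideal.mul_mem_mul hj₁ h.snd_mem)
    obtain ⟨u, hu⟩ := hj₀.exists_left_inv
    obtain ⟨a, b, rfl⟩ := h.exists_eq hg
    have hIT : I ≤ I ⊔ maximalIdeal R • maximalIdeal R ^ 2 := le_sup_left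
    have hxy2 : x * y ∈ maximalIdeal R ^ 2 := pow_two (maximalIdeal R) ▸
      Ideal.mul_mem_mul h.fst_mem h.snd_mem
    have hT : ∀ {z}, z ∈ maximalIdeal R ^ 2 →
        j₁ * z ∈ I ⊔ maximalIdeal R • maximalIdeal R ^ 2 := fun hz =>
      Submodule.mem_sup_right (Submodule.smul_mem_smul hj₁ hz)
    have hx2 : x ^ 2 ∈ I ⊔ maximalIdeal R • maximalIdeal R ^ 2 := by
      convert Ideal.mul_mem_left _ u (sub_mem (hIT hj) (hT hxy2)) using 1
      linear_combination -x ^ 2 * hu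
    have hxy : x * y ∈ I ⊔ maximalIdeal R • maximalIdeal R ^ 2 := by
      convert Ideal.mul_mem_left _ u (sub_mem (hIT (hy hj))
        (hT (Ideal.pow_mem_pow h.snd_mem 2))) using 1
      linear_combination -x * y * hu
    have hy2 : y ^ 2 ∈ I ⊔ maximalIdeal R • maximalIdeal R ^ 2 := by
      convert sub_mem (hIT hf)
        (add_mem (Ideal.mul_mem_left _ a hx2) (Ideal.mul_mem_left _ b hxy)) using 1
      ring
    have hle : maximalIdeal R ^ 2 ≤ I := by
      refine Submodule.le_of_le_smul_of_le_jacobson_bot (IsNoetherian.noetherian _)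
        (maximalIdeal_le_jacobson _) fun z hz => ?_
      obtain ⟨p, q, r, rfl⟩ := h.exists_quadratic hz
      exact add_mem (add_mem (Ideal.mul_mem_left _ p hx2) (Ideal.mul_mem_left _ q hxy))
        (Ideal.mul_mem_left _ r hy2)
    exact (hs.2 _ _ ((le_antisymm hI2 hle).trans (pow_two _))).elim htop htop

theorem IsParams.sup_eq_of_colon (hdim : ringKrullDim R = 2) {x y : R} (h : IsParams x y)
    {J K : Ideal R} (hJ : J ≤ maximalIdeal R) (hJ2 : ¬ J ≤ maximalIdeal R ^ 2)
    (hK : K ≤ maximalIdeal R) {g : R} (hg : g ∈ maximalIdeal R) (hf : y ^ 2 + x * g ∈ J * K)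
    {j : R} (hj : x * j ∈ J * K) (hj2 : j ∉ maximalIdeal R ^ 2) : J ⊔ K = maximalIdeal R := by
  by_contra hsup
  obtain ⟨l, hl, hsq⟩ := exists_sq_of_sup_ne h hJ hJ2 hK hsup
  obtain ⟨a, b, rfl⟩ := h.exists_eq hl
  obtain ⟨p, q, rfl⟩ := h.exists_eq hg
  have hJK : J * K ≤ maximalIdeal R ^ 2 := pow_two (maximalIdeal R) ▸ Ideal.mul_mono hJ hK
  obtain ⟨j₀, j₁, rfl⟩ := h.exists_eq (a := j) (by
    simpa using h.mem_pow_of_mul_mem hdim (r := 1) (hJK hj))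
  obtain ⟨c, hc⟩ := hsq _ hj
  obtain ⟨d, hd⟩ := hsq _ hf
  obtain ⟨h1, h2, h3⟩ := h.coeffs_of_quadratic_mem hdim (a := j₀ - c * a ^ 2)
    (b := j₁ - 2 * c * a * b) (c := -c * b ^ 2) (by convert hc using 1; ring)
  obtain ⟨-, -, h4⟩ := h.coeffs_of_quadratic_mem hdim (a := p - d * a ^ 2)
    (b := q - 2 * d * a * b) (c := 1 - d * b ^ 2) (by convert hd using 1; ring)
  by_cases hb : b ∈ maximalIdeal R
  · exact absurd (add_mem h4 (Ideal.mul_mem_left _ (d * b) hb)) (by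
      rw [pow_two, ← mul_assoc, sub_add_cancel]
      exact (Ideal.ne_top_iff_one _).1 (maximalIdeal.isMaximal R).ne_top)
  · have hcm : c ∈ maximalIdeal R := by
      rw [neg_mul, neg_mem_iff] at h3
      exact ((maximalIdeal.isMaximal R).isPrime.mem_or_mem h3).resolve_right fun h =>
        hb (Ideal.IsPrime.mem_of_pow_mem inferInstance 2 h)
    refine hj2 ?_
    rw [pow_two]
    refine add_mem (Ideal.mul_mem_mul ?_ h.fst_mem) (Ideal.mul_mem_mul ?_ h.snd_mem)
    · convert add_mem h1 (Ideal.mul_mem_left _ (a ^ 2) hcm) using 1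
      ring
    · convert add_mem h2 (Ideal.mul_mem_left _ (2 * a * b) hcm) using 1
      ring

/-- The stated conditions give an indecomposable integrally closed module with minors `I`. -/
theorem exists_module_of_conditions [Infinite (ResidueField R)] (hdim : ringKrullDim R = 2)
    {x₀ y₀ : R} (h₀ : IsParams x₀ y₀) {I : Ideal R} (hI0 : I ≠ ⊥) (hI : IsIntClIdeal I)
    (hrad : I.radical = maximalIdeal R) (hI2 : I ≤ maximalIdeal R ^ 2)
    (hcond : ¬ I ≤ maximalIdeal R ^ 3 → IsSimpleIdeal I ∨
      ∃ J K : Ideal R, J ≠ ⊤ ∧ K ≠ ⊤ ∧ I = J * K ∧ J ⊔ K ≠ maximalIdeal R) :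
    ∃ M : Submodule R (Fin 2 → R), IsIntClMod M ∧ IsIndecomposable M ∧ minorsIdeal M = I := by
  obtain ⟨s, hs, hs'⟩ := exists_order hI0 hI2
  obtain ⟨x, g, h, hg, hf⟩ := h₀.exists_monic_mem hs hs'
  rw [show s + 2 - 1 = s + 1 by omega] at hg
  have hminors := h.minorsIdeal_detColon hdim hI hs hg hf
  refine ⟨detColon I x y₀, isIntClMod_detColon hI hminors, ?_, hminors⟩
  cases s with
  | succ s => exact h.isIndecomposable_of_order_ge_three hdim hrad hs hg hf
  | zero =>
    rw [zero_add, pow_one] at hg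
    rw [zero_add] at hf hs'
    have hcond := hcond hs'
    have hcolon : ∀ j, x * j ∈ I → j ∈ maximalIdeal R ^ 2 := by
      intro j hj
      by_contra hj2
      obtain hsim | ⟨J, K, hJ, hK, rfl, hsup⟩ := hcond
      · exact h.not_isSimpleIdeal_of_colon hdim hI hI2 hg hf hj hj2 hsim
      · obtain ⟨hJm, hJ2, hKm, -⟩ := le_maximalIdeal_of_mul rfl hJ hK hs'
        exact hsup (h.sup_eq_of_colon hdim hJm hJ2 hKm hg hf hj hj2)
    refine (h.isIndecomposable_or_exists hdim hrad hI2 hg hf hcolon).resolve_right ?_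
    rintro ⟨x', y', f, h', hfI, hfxy⟩
    obtain ⟨x, y, h, hxy⟩ := h'.exists_mul_mem hrad hfI hfxy
    obtain hsim | ⟨J, K, hJ, hK, rfl, hsup⟩ := hcond
    · exact h.not_isSimpleIdeal_of_mul_mem hdim hI hI2 hxy hsim
    · obtain ⟨hJm, hJ2, hKm, -⟩ := le_maximalIdeal_of_mul rfl hJ hK hs'
      exact hsup (h.sup_eq_of_mul_mem hdim hJm hJ2 hKm hxy)

end OrderTwo

theorem stmt19 [IsNoetherianRing R] [IsLocalRing R] [IsDomain R]
    [Infinite (ResidueField R)]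
    (hdim : ringKrullDim R = 2)
    (hreg : ∃ x y : R, maximalIdeal R = Ideal.span {x, y})
    (I : Ideal R) (hicl : IsIntClIdeal I) (hprim : I.radical = maximalIdeal R) :
    (∃ M : Submodule R (Fin 2 → R), M.FG ∧ minorsIdeal M ≠ ⊥ ∧
        IsIntClMod M ∧ IsIndecomposable M ∧ minorsIdeal M = I) ↔
      (I ≤ maximalIdeal R ^ 3 ∨
        ((I ≤ maximalIdeal R ^ 2 ∧ ¬ I ≤ maximalIdeal R ^ 3) ∧ IsSimpleIdeal I) ∨
        ((I ≤ maximalIdeal R ^ 2 ∧ ¬ I ≤ maximalIdeal R ^ 3) ∧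
          ∃ J K : Ideal R, IsSimpleIdeal J ∧ IsSimpleIdeal K ∧
            IsIntClIdeal J ∧ IsIntClIdeal K ∧ I = J * K ∧
            J ⊔ K ≠ maximalIdeal R)) := by
  obtain ⟨x, y, h⟩ := hreg
  replace h : IsParams x y := h
  have hI0 : I ≠ ⊥ := by
    rintro rfl
    obtain ⟨n, hn⟩ : x ∈ (⊥ : Ideal R).radical := hprim ▸ h.fst_mem
    exact (h.prime_fst hdim).ne_zero (IsReduced.eq_zero x ⟨n, hn⟩)
  constructor
  · rintro ⟨M, -, h0, hM, hind, rfl⟩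
    by_cases hI3 : minorsIdeal M ≤ maximalIdeal R ^ 3
    · exact .inl hI3
    obtain ⟨hI2, hns⟩ := conditions_of_isIndecomposable hdim h h0 hM hind hicl hprim hI3
    by_cases hs : IsSimpleIdeal (minorsIdeal M)
    · exact .inr (.inl ⟨⟨hI2, hI3⟩, hs⟩)
    · exact .inr (.inr ⟨⟨hI2, hI3⟩, hns hs⟩)
  · intro hcond
    have hI2 : I ≤ maximalIdeal R ^ 2 := by
      obtain hI3 | hI2 | hI2 := hcond
      exacts [hI3.trans (Ideal.pow_le_pow_right (by omega)), hI2.1.1, hI2.1.1]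
    obtain ⟨M, hM, hind, hMI⟩ := exists_module_of_conditions hdim h hI0 hicl hprim hI2 (by
      obtain hI3 | ⟨-, hs⟩ | ⟨-, J, K, hJ, hK, -, -, e, hsup⟩ := hcond
      exacts [fun hn => absurd hI3 hn, fun _ => .inl hs,
        fun _ => .inr ⟨J, K, hJ.1, hK.1, e, hsup⟩])
    exact ⟨M, IsNoetherian.noetherian _, hMI ▸ hI0, hM, hind, hMI⟩
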